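/- Let 1 ≤ i ≤ n−p and let C be a connected component of the real variety S_ℝ containing a regular point of S. Then there exists a nonempty subset O_C^{(i)} of ℝ^{(n−p−i+1)×n}, open with respect to the Euclidean topology, such that every matrix a ∈ O_C^{(i)} has maximal rank n−p−i+1, the dual polar variety W_{\bar K(\bar a)}(S) is generic (i.e., empty or of pure codimension i in S), and the real dual polar variety W_{\bar K(\bar a)}(S_ℝ) contains a regular point of C. -/

import Mathlib

open MvPolynomial

noncomputable section

/-- The Zariski closure of a subset of the affine space `σ → ℂ`. -/
def zcl {σ : Type} (T : Set (σ → ℂ)) : Set (σ → ℂ) :=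
  MvPolynomial.zeroLocus ℂ (MvPolynomial.vanishingIdeal ℂ T)

/-- Zariski open subsets of the affine space `σ → ℂ`. -/
def ZOpen {σ : Type} (U : Set (σ → ℂ)) : Prop :=
  ∃ I : Ideal (MvPolynomial σ ℂ), U = {x | ∃ f ∈ I, MvPolynomial.eval x f ≠ 0}

/-- Zariski open subsets of the space of `m × n` complex matrices. -/
def ZOpenMat {m n : ℕ} (U : Set (Matrix (Fin m) (Fin n) ℂ)) : Prop :=
  ∃ I : Ideal (MvPolynomial (Fin m × Fin n) ℂ),
    U = {a | ∃ f ∈ I, MvPolynomial.eval (fun q => a q.1 q.2) f ≠ 0}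

/-- `T` is of pure dimension `d`: every irreducible component of (the Zariski closure of) `T`,
i.e. every minimal prime over its vanishing ideal, has coordinate ring of Krull dimension `d`. -/
def IsPureDim {σ : Type} (T : Set (σ → ℂ)) (d : ℕ) : Prop :=
  ∀ P ∈ (MvPolynomial.vanishingIdeal ℂ T).minimalPrimes,
    ringKrullDim (MvPolynomial σ ℂ ⧸ P) = (d : WithBot (WithTop ℕ))

/-- The Zariski tangent space at a point `x` of (the Zariski closure of) a subset `T`
of affine space: the common kernel of the differentials at `x` of all polynomials
vanishing on `T`. -/
def tangentAt {σ : Type} [Fintype σ] [DecidableEq σ] (T : Set (σ → ℂ)) (x : σ → ℂ) :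
    Submodule ℂ (σ → ℂ) :=
  ⨅ (f : MvPolynomial σ ℂ) (_ : f ∈ MvPolynomial.vanishingIdeal ℂ T),
    LinearMap.ker
      (∑ l, MvPolynomial.eval x (MvPolynomial.pderiv l f) •
        (LinearMap.proj l : (σ → ℂ) →ₗ[ℂ] ℂ))

/-- `rs` is a regular sequence in the commutative ring `R`. -/
def IsRegSeq {R : Type*} [CommRing R] (rs : List R) : Prop :=
  Ideal.span {x | x ∈ rs} ≠ ⊤ ∧
  ∀ j, j < rs.length → ∀ b : R,
    rs.getD j 0 * b ∈ Ideal.span {x | x ∈ rs.take j} →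
    b ∈ Ideal.span {x | x ∈ rs.take j}

/-- The common zero set in `ℂⁿ` of polynomials `F₁, …, F_p ∈ ℚ[X₁, …, Xₙ]`. -/
def zeroSetC {n p : ℕ} (F : Fin p → MvPolynomial (Fin n) ℚ) : Set (Fin n → ℂ) :=
  {x | ∀ k, MvPolynomial.aeval x (F k) = 0}

/-- The Jacobian matrix `[∂F_k/∂X_l]` evaluated at `x ∈ ℂⁿ`. -/
def jacC {n p : ℕ} (F : Fin p → MvPolynomial (Fin n) ℚ) (x : Fin n → ℂ) :
    Matrix (Fin p) (Fin n) ℂ :=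
  Matrix.of fun k l => MvPolynomial.aeval x (MvPolynomial.pderiv l (F k))

/-- The set of regular points of `S = {F₁ = 0, …, F_p = 0}`: points of `S` where the
Jacobian has maximal rank `p`. -/
def SregC {n p : ℕ} (F : Fin p → MvPolynomial (Fin n) ℚ) : Set (Fin n → ℂ) :=
  {x | x ∈ zeroSetC F ∧ (jacC F x).rank = p}

/-- The classic polar variety: the Zariski closure of the locus of regular points of `S`
where the matrix obtained by appending the rows of `a` to the Jacobian has rank at
most `r` (i.e. where all `(r+1)`-minors vanish). -/
def Wclassic {n p m : ℕ} (F : Fin p → MvPolynomial (Fin n) ℚ)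
    (a : Matrix (Fin m) (Fin n) ℂ) (r : ℕ) : Set (Fin n → ℂ) :=
  zcl {x | x ∈ SregC F ∧ (Matrix.fromRows (jacC F x) a).rank ≤ r}

/-- The dual polar variety: as `Wclassic`, with appended rows `(a_{k,1} - X₁, …, a_{k,n} - Xₙ)`. -/
def Wdual {n p m : ℕ} (F : Fin p → MvPolynomial (Fin n) ℚ)
    (a : Matrix (Fin m) (Fin n) ℂ) (r : ℕ) : Set (Fin n → ℂ) :=
  zcl {x | x ∈ SregC F ∧
    (Matrix.fromRows (jacC F x) (Matrix.of fun k l => a k l - x l)).rank ≤ r}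

/-- `F₁, …, F_p` generate the full vanishing ideal of their zero set (over `ℂ`);
this encodes that `(F₁, …, F_p)` is reduced (radical) and the ideal of definition of `S`. -/
def idealOfDef {n p : ℕ} (F : Fin p → MvPolynomial (Fin n) ℚ) : Prop :=
  MvPolynomial.vanishingIdeal ℂ (zeroSetC F) =
    Ideal.span (Set.range fun k => MvPolynomial.map (algebraMap ℚ ℂ) (F k))

/-- The submatrix of the first `m` rows of a matrix. -/
def firstRows {N n' m : ℕ} (a : Matrix (Fin N) (Fin n') ℂ) (h : m ≤ N) :
    Matrix (Fin m) (Fin n') ℂ :=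
  Matrix.of fun k l => a (Fin.castLE h k) l

/-- The matrix obtained by deleting row `h`. -/
def rowErase {m n' : ℕ} (a : Matrix (Fin (m + 1)) (Fin n') ℂ) (h : Fin (m + 1)) :
    Matrix (Fin m) (Fin n') ℂ :=
  Matrix.of fun k l => a (h.succAbove k) l

/-- The real trace `S_ℝ := S ∩ ℝⁿ`, as a subset of Euclidean space. -/
def SR {n p : ℕ} (F : Fin p → MvPolynomial (Fin n) ℚ) : Set (EuclideanSpace ℝ (Fin n)) :=
  {x | (fun j => (x j : ℂ)) ∈ zeroSetC F}

/-- `C` is a connected component of `T`. -/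
def IsConnCompOf {α : Type*} [TopologicalSpace α] (C T : Set α) : Prop :=
  C.Nonempty ∧ C ⊆ T ∧ IsPreconnected C ∧
    ∀ D, C ⊆ D → D ⊆ T → IsPreconnected D → D = C

end

universe u

/-- Krull dimension is unchanged along an injective integral extension. -/
theorem ringKrullDim_eq_of_isIntegral_of_injective {R S : Type*} [CommRing R] [CommRing S]
    [Algebra R S] [Algebra.IsIntegral R S] [FaithfulSMul R S] :
    ringKrullDim S = ringKrullDim R := by
  refine le_antisymm ?_ ?_
  · refine Order.krullDim_le_of_strictMono (PrimeSpectrum.comap (algebraMap R S)) ?_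
    intro P Q h
    exact Ideal.IsIntegral.comap_lt_comap (R := R) (show P.asIdeal < Q.asIdeal from h)
  · refine iSup_le fun l => ?_
    obtain ⟨P, hP1, hP2⟩ := (inferInstance : Nonempty (Ideal.primesOver l.head.asIdeal S))
    obtain ⟨L, hL, -⟩ := Ideal.exists_ltSeries_of_hasGoingUp (S := S) l P
    rw [← hL]
    exact le_iSup (fun l : LTSeries (PrimeSpectrum S) => (l.length : WithBot ℕ∞)) L

/-- The Krull dimension of a finitely generated domain over a field is its transcendence degree. -/
theorem exists_ringKrullDim_eq_and_trdeg_eq (k B : Type u) [Field k] [CommRing B] [IsDomain B]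
    [Algebra k B] [Algebra.FiniteType k B] :
    ∃ s : ℕ, ringKrullDim B = s ∧ Algebra.trdeg k B = s := by
  obtain ⟨s, g, hinj, hg_int⟩ := exists_integral_inj_algHom_of_fg k B
  refine ⟨s, ?_⟩
  algebraize [g.toRingHom]
  have hf : FaithfulSMul (MvPolynomial (Fin s) k) B :=
    (faithfulSMul_iff_algebraMap_injective _ _).mpr hinj
  have : Algebra.IsIntegral (MvPolynomial (Fin s) k) B := ⟨hg_int⟩
  have : IsScalarTower k (MvPolynomial (Fin s) k) B :=
    IsScalarTower.of_algebraMap_eq fun x => (g.commutes x).symm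
  constructor
  · rw [ringKrullDim_eq_of_isIntegral_of_injective (R := MvPolynomial (Fin s) k),
      MvPolynomial.ringKrullDim_of_isNoetherianRing]
    simp
  · rw [← trdeg_add_eq k (MvPolynomial (Fin s) k) (A := B),
      trdeg_eq_zero (R := MvPolynomial (Fin s) k), add_zero]
    simp

/-- In a hypersurface `q = 0`, the variables other than one occurring in `q` remain
algebraically independent. -/
theorem natCast_le_trdeg_quotient_add_one {k B : Type u} [Field k] [CommRing B] {s : ℕ}
    [Algebra k B] (g : MvPolynomial (Fin s) k →ₐ[k] B) {q : MvPolynomial (Fin s) k}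
    (hq : Prime q) (h : ∀ a, g a = 0 → q ∣ a) : (s : Cardinal.{u}) ≤ Algebra.trdeg k B + 1 := by
  have : Nontrivial B := by
    by_contra hB
    rw [not_nontrivial_iff_subsingleton] at hB
    exact hq.not_isUnit (isUnit_of_dvd_one (h 1 (Subsingleton.elim _ _)))
  have : ∃ i, degreeOf i q ≠ 0 := by
    by_contra! hd
    obtain ⟨c, rfl⟩ : ∃ c, q = C c := by
      refine ⟨coeff 0 q, totalDegree_eq_zero_iff_eq_C.mp ?_⟩
      refine (totalDegree_eq_zero_iff _ _).mpr fun m hm i => ?_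
      have := monomial_le_degreeOf i hm
      have := hd i
      omega
    refine hq.not_isUnit ((IsUnit.mk0 c ?_).map C)
    rintro rfl
    exact hq.ne_zero (by simp)
  obtain ⟨i, hi⟩ := this
  have hind : AlgebraicIndependent k (fun j : {j // j ≠ i} => g (X j.1)) := by
    rw [algebraicIndependent_iff]
    intro f hf
    have : g (rename Subtype.val f) = 0 := by
      rw [← hf, ← AlgHom.comp_apply]
      congr 1
      ext j
      simp
    obtain ⟨r, hr⟩ := h _ this
    by_contra hf0
    have h0 : rename (Subtype.val : {j // j ≠ i} → Fin s) f ≠ 0 := by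
      rwa [Ne, map_eq_zero_iff _ (rename_injective _ Subtype.val_injective)]
    have hr0 : r ≠ 0 := by rintro rfl; simp [hr] at h0
    have h1 : degreeOf i (rename (Subtype.val : {j // j ≠ i} → Fin s) f) = 0 := by
      rw [← Nat.le_zero, degreeOf_le_iff]
      intro m hm
      classical
      rw [support_rename_of_injective Subtype.val_injective] at hm
      obtain ⟨m', -, rfl⟩ := Finset.mem_image.mp hm
      exact (Finsupp.mapDomain_of_notMem_range _ _ (by simp)).le
    rw [hr, degreeOf_mul_eq hq.ne_zero hr0] at h1
    omega
  have := hind.lift_cardinalMk_le_trdeg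
  simp only [Cardinal.mk_fintype, ne_eq, Fintype.card_subtype_compl, Fintype.card_fin,
    Fintype.card_unique, Cardinal.lift_natCast, Cardinal.lift_uzero] at this
  calc (s : Cardinal.{u}) ≤ ((s - 1 : ℕ) : Cardinal.{u}) + 1 := by
        norm_cast; omega
    _ ≤ _ := by gcongr

/-- A minimal prime over a principal ideal lowers the transcendence degree by at most one. -/
theorem trdeg_le_trdeg_quotient_add_one_of_mem_minimalPrimes {k B : Type u} [Field k] [CommRing B]
    [IsDomain B] [Algebra k B] [Algebra.FiniteType k B] {x : B} {P : Ideal B}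
    (hP : P ∈ (Ideal.span {x}).minimalPrimes) :
    Algebra.trdeg k B ≤ Algebra.trdeg k (B ⧸ P) + 1 := by
  have hPp : P.IsPrime := hP.1.1
  obtain ⟨s, g, hinj, hg_int⟩ := exists_integral_inj_algHom_of_fg k B
  algebraize [g.toRingHom]
  have hf : FaithfulSMul (MvPolynomial (Fin s) k) B :=
    (faithfulSMul_iff_algebraMap_injective _ _).mpr hinj
  have : Algebra.IsIntegral (MvPolynomial (Fin s) k) B := ⟨hg_int⟩
  have : IsScalarTower k (MvPolynomial (Fin s) k) B :=
    IsScalarTower.of_algebraMap_eq fun x => (g.commutes x).symm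
  have : IsNoetherianRing B := Algebra.FiniteType.isNoetherianRing k B
  have hs : Algebra.trdeg k B = s := by
    rw [← trdeg_add_eq k (MvPolynomial (Fin s) k) (A := B),
      trdeg_eq_zero (R := MvPolynomial (Fin s) k), add_zero]
    simp
  rw [hs]
  by_cases hbot : P.under (MvPolynomial (Fin s) k) = ⊥
  · have : Function.Injective ((Ideal.Quotient.mkₐ k P).comp g) := by
      rw [injective_iff_map_eq_zero]
      intro a ha
      have : a ∈ P.under (MvPolynomial (Fin s) k) :=
      Ideal.Quotient.eq_zero_iff_mem (I := P).mp ha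
      simpa [hbot] using this
    refine le_trans ?_ (self_le_add_right _ _)
    refine le_trans ?_ (trdeg_le_of_injective _ this)
    simp
  · obtain ⟨c, hc, hc0⟩ := Submodule.exists_mem_ne_zero_of_ne_bot hbot
    obtain ⟨q, hqp, hq⟩ := Ideal.IsPrime.exists_mem_prime_of_ne_bot
      (inferInstance : (P.under (MvPolynomial (Fin s) k)).IsPrime) hbot
    have hqP : (Ideal.span {q}).IsPrime := (Ideal.span_singleton_prime hq.ne_zero).mpr hq
    have hle : Ideal.span {q} ≤ P.under (MvPolynomial (Fin s) k) := by
      simpa [Ideal.span_le] using hqp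
    have heq : Ideal.span {q} = P.under (MvPolynomial (Fin s) k) := by
      by_contra hne
      obtain ⟨P', hP', hP'p, hP'l⟩ :=
        Ideal.exists_ideal_lt_liesOver_of_lt P (lt_of_le_of_ne hle hne)
      have hbP' : ⊥ < P' := by
        rw [bot_lt_iff_ne_bot]
        rintro rfl
        have h1 : q ∈ (⊥ : Ideal B).under (MvPolynomial (Fin s) k) := by
          rw [← hP'l.over]
          exact Ideal.mem_span_singleton_self q
        rw [Ideal.under, Ideal.mem_comap, Ideal.mem_bot] at h1
        exact hq.ne_zero (hinj (h1.trans (map_zero g).symm))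
      have h1 := Ideal.height_add_one_le_of_lt_of_isPrime hbP'
      have h2 := Ideal.height_add_one_le_of_lt_of_isPrime hP'
      have h3 := Ideal.height_le_one_of_isPrincipal_of_mem_minimalPrimes (Ideal.span {x}) P hP
      have h4 := (add_le_add_left h1 1).trans (h2.trans h3)
      rw [Ideal.height_bot] at h4
      norm_num at h4
    refine natCast_le_trdeg_quotient_add_one ((Ideal.Quotient.mkₐ k P).comp g) hq fun a ha => ?_
    have : a ∈ P.under (MvPolynomial (Fin s) k) :=
      Ideal.Quotient.eq_zero_iff_mem (I := P).mp ha
    rwa [← heq, Ideal.mem_span_singleton] at this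

/-- A prime minimal over the sum of a prime and an ideal with `r` generators lowers the
transcendence degree by at most `r`. -/
theorem trdeg_quotient_le_trdeg_quotient_add_card {k A : Type u} [Field k] [CommRing A]
    [Algebra k A] [Algebra.FiniteType k A] {I : Ideal A} [hI : I.IsPrime] (s : Finset A)
    {Q : Ideal A} (hQ : Q ∈ (I ⊔ Ideal.span (s : Set A)).minimalPrimes) :
    Algebra.trdeg k (A ⧸ I) ≤ Algebra.trdeg k (A ⧸ Q) + s.card := by
  classical
  induction s using Finset.induction_on generalizing Q with
  | empty =>
    have : Q = I := by
      simp only [Finset.coe_empty, Ideal.span_empty, bot_le, sup_of_le_left] at hQ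
      exact le_antisymm (hQ.2 ⟨hI, le_rfl⟩ hQ.1.2) hQ.1.2
    subst this
    simp
  | insert x s hx ih =>
    have hQp : Q.IsPrime := hQ.1.1
    have hsup : I ⊔ Ideal.span ((insert x s : Finset A) : Set A) =
        (I ⊔ Ideal.span (s : Set A)) ⊔ Ideal.span {x} := by
      rw [Finset.coe_insert, Ideal.span_insert, sup_comm (Ideal.span {x}), sup_assoc]
    rw [hsup] at hQ
    obtain ⟨Q₁, hQ₁, hQ₁Q⟩ := Ideal.exists_minimalPrimes_le (le_sup_left.trans hQ.1.2)
    have hQ₁p : Q₁.IsPrime := hQ₁.1.1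
    have hmap : Q.map (Ideal.Quotient.mkₐ k Q₁) ∈
        (Ideal.span {Ideal.Quotient.mk Q₁ x}).minimalPrimes := by
      have hxQ : x ∈ Q := hQ.1.2 (Ideal.mem_sup_right (Ideal.mem_span_singleton_self x))
      refine ⟨⟨Ideal.map_isPrime_of_surjective Ideal.Quotient.mk_surjective (by simpa), ?_⟩, ?_⟩
      · rw [Ideal.span_singleton_le_iff_mem]
        exact Ideal.mem_map_of_mem (Ideal.Quotient.mkₐ k Q₁) hxQ
      · rintro J ⟨hJp, hJ⟩ hJQ
        have : Q ≤ J.comap (Ideal.Quotient.mk Q₁) := by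
          refine hQ.2 ⟨hJp.comap _, sup_le (hQ₁.1.2.trans ?_) ?_⟩ ?_
          · intro y hy
            rw [Ideal.mem_comap, Ideal.Quotient.eq_zero_iff_mem.mpr hy]
            exact J.zero_mem
          · rw [Ideal.span_singleton_le_iff_mem]
            exact hJ (Ideal.mem_span_singleton_self _)
          · intro y hy
            have := hJQ hy
            obtain ⟨z, hz, hzy⟩ := (Ideal.mem_map_iff_of_surjective (Ideal.Quotient.mkₐ k Q₁)
              (Ideal.Quotient.mkₐ_surjective k Q₁)).mp this
            have : z - y ∈ Q := hQ₁Q (Ideal.Quotient.eq.mp hzy)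
            simpa using Q.sub_mem hz this
        rw [Ideal.map_le_iff_le_comap]
        exact this
    have h1 := trdeg_le_trdeg_quotient_add_one_of_mem_minimalPrimes (k := k) hmap
    rw [(DoubleQuot.quotQuotEquivQuotOfLEₐ k hQ₁Q).trdeg_eq] at h1
    calc _ ≤ _ := ih hQ₁
      _ ≤ _ := add_le_add_left h1 _
      _ = _ := by rw [Finset.card_insert_of_notMem hx]; push_cast; ring

section Minors

variable {K ι κ : Type*} [Field K] [Fintype ι] [Fintype κ]

/-- A matrix with linearly independent rows has a nonzero maximal minor. -/
theorem Matrix.exists_det_submatrix_ne_zero [DecidableEq ι] {M : Matrix ι κ K}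
    (h : LinearIndependent K M.row) : ∃ e : ι → κ, (M.submatrix id e).det ≠ 0 := by
  obtain ⟨b, hb, hspan, hli⟩ := exists_linearIndependent K (Set.range M.col)
  have htop : Submodule.span K b = ⊤ := by
    rw [hspan]
    apply Submodule.eq_top_of_finrank_eq
    rw [← Matrix.rank_eq_finrank_span_cols, h.rank_matrix, Module.finrank_pi]
  let B := Module.Basis.mk hli (by simp [htop])
  have : Fintype b := FiniteDimensional.fintypeBasisIndex B
  have hcard : Fintype.card ι = Fintype.card b := by
    rw [← Module.finrank_eq_card_basis B, Module.finrank_pi]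
  let f : ι ≃ b := Fintype.equivOfCardEq hcard
  choose e he using fun i => hb (f i).2
  refine ⟨e, ?_⟩
  have hcol : LinearIndependent K (M.submatrix id e).col := by
    have : (M.submatrix id e).col = (fun x : b => (x : ι → K)) ∘ f := by
      ext i j
      exact congrFun (he i) j
    rw [this]
    exact hli.comp _ f.injective
  rw [Matrix.linearIndependent_cols_iff_isUnit, Matrix.isUnit_iff_isUnit_det] at hcol
  exact hcol.ne_zero

theorem Matrix.linearIndependent_row_iff_rank {M : Matrix ι κ K} :
    LinearIndependent K M.row ↔ M.rank = Fintype.card ι := by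
  rw [linearIndependent_iff_card_eq_finrank_span, Matrix.rank_eq_finrank_span_row, Set.finrank,
    eq_comm]

theorem Matrix.exists_vecMul_eq_zero_of_rank_lt {M : Matrix ι κ K}
    (h : M.rank < Fintype.card ι) : ∃ u ≠ 0, Matrix.vecMul u M = 0 := by
  have : ¬ Function.Injective M.vecMul := by
    rw [Matrix.vecMul_injective_iff, Matrix.linearIndependent_row_iff_rank]
    exact h.ne
  rw [Function.Injective] at this
  push Not at this
  obtain ⟨u, v, huv, hne⟩ := this
  exact ⟨u - v, sub_ne_zero.mpr hne, by rw [Matrix.sub_vecMul, sub_eq_zero]; exact huv⟩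

theorem Matrix.rank_lt_of_vecMul_eq_zero {M : Matrix ι κ K} {u : ι → K} (hu : u ≠ 0)
    (h : Matrix.vecMul u M = 0) : M.rank < Fintype.card ι := by
  refine lt_of_le_of_ne (Matrix.rank_le_card_height M) fun hr => hu ?_
  rw [← Matrix.linearIndependent_row_iff_rank, ← Matrix.vecMul_injective_iff] at hr
  exact hr (by simpa using h)

end Minors

section PolarMatrix

variable {n p m : ℕ} (G : Fin p → MvPolynomial (Fin n) ℂ)

/-- The Jacobian matrix of `G` at a point with coordinates in a `ℂ`-algebra. -/
noncomputable def jacobianAt {A : Type*} [CommRing A] [Algebra ℂ A] (x : Fin n → A) :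
    Matrix (Fin p) (Fin n) A :=
  Matrix.of fun t l => aeval x (pderiv l (G t))

/-- The Jacobian matrix of `G` at a point `x`, with the rows `a k - x` appended. -/
noncomputable def polarMatrix {A : Type*} [CommRing A] [Algebra ℂ A] (x : Fin n → A)
    (a : Matrix (Fin m) (Fin n) A) : Matrix (Fin p ⊕ Fin m) (Fin n) A :=
  Matrix.fromRows (jacobianAt G x) (Matrix.of fun k l => a k l - x l)

/-- The matrix `b` with the row `w` inserted at position `j`. -/
def insertRow {A : Type*} (j : Fin (m + 1)) (w : Fin n → A) (b : Matrix (Fin m) (Fin n) A) :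
    Matrix (Fin (m + 1)) (Fin n) A :=
  Matrix.of fun k l => j.insertNth (α := fun _ => A) (w l) (fun t => b t l) k

/-- The row which is dependent on the rows of `polarMatrix G x b` modulo `x`, with
coefficients `v`. -/
noncomputable def dependentRow {A : Type*} [CommRing A] [Algebra ℂ A] (x : Fin n → A)
    (b : Matrix (Fin m) (Fin n) A) (v : Fin p ⊕ Fin m → A) : Fin n → A :=
  x + Matrix.vecMul v (polarMatrix G x b)

variable {G} {A B : Type*} [CommRing A] [Algebra ℂ A] [CommRing B] [Algebra ℂ B]

@[simp]
theorem insertRow_same {A : Type*} (j : Fin (m + 1)) (w : Fin n → A) (b : Matrix (Fin m) (Fin n) A)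
    (l : Fin n) : insertRow j w b j l = w l := by
  simp [insertRow]

@[simp]
theorem insertRow_succAbove {A : Type*} (j : Fin (m + 1)) (w : Fin n → A)
    (b : Matrix (Fin m) (Fin n) A) (k : Fin m) (l : Fin n) :
    insertRow j w b (j.succAbove k) l = b k l := by
  simp [insertRow]

theorem map_jacobianAt (f : A →ₐ[ℂ] B) (x : Fin n → A) :
    (jacobianAt G x).map f = jacobianAt G (f ∘ x) := by
  ext t l
  simp only [jacobianAt, Matrix.map_apply, Matrix.of_apply]
  rw [← AlgHom.comp_apply, comp_aeval]
  rfl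

theorem map_polarMatrix (f : A →ₐ[ℂ] B) (x : Fin n → A) (a : Matrix (Fin m) (Fin n) A) :
    (polarMatrix G x a).map f = polarMatrix G (f ∘ x) (a.map f) := by
  ext (t | k) l
  · exact congrFun (congrFun (map_jacobianAt (G := G) f x) t) l
  · simp [polarMatrix]

theorem map_dependentRow (f : A →ₐ[ℂ] B) (x : Fin n → A) (b : Matrix (Fin m) (Fin n) A)
    (v : Fin p ⊕ Fin m → A) (l : Fin n) :
    f (dependentRow G x b v l) = dependentRow G (f ∘ x) (b.map f) (f ∘ v) l := by
  simp only [dependentRow, Pi.add_apply, map_add, Function.comp_apply]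
  congr 1
  rw [← map_polarMatrix]
  exact RingHom.map_vecMul (f : A →+* B) _ _ _

theorem det_polarMatrix_insertRow [IsDomain A] (x : Fin n → A) (b : Matrix (Fin m) (Fin n) A)
    (v : Fin p ⊕ Fin m → A) (j : Fin (m + 1)) (e : Fin p ⊕ Fin (m + 1) → Fin n) :
    ((polarMatrix G x (insertRow j (dependentRow G x b v) b)).submatrix id e).det = 0 := by
  rw [← Matrix.exists_vecMul_eq_zero_iff]
  refine ⟨Sum.elim (fun t => - v (Sum.inl t))
    (j.insertNth (α := fun _ => A) 1 fun k => - v (Sum.inr k)), ?_, ?_⟩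
  · intro h
    simpa using congrFun h (Sum.inr j)
  · ext l
    simp only [Matrix.vecMul, dotProduct, Fintype.sum_sum_type, Sum.elim_inl, Sum.elim_inr,
      Matrix.submatrix_apply, id, polarMatrix, Matrix.fromRows_apply_inl,
      Matrix.fromRows_apply_inr, Matrix.of_apply, Pi.zero_apply]
    rw [Fin.sum_univ_succAbove _ j]
    simp only [insertRow_same, insertRow_succAbove, Fin.insertNth_apply_same,
      Fin.insertNth_apply_succAbove, dependentRow,
      Pi.add_apply, Matrix.vecMul, dotProduct, Fintype.sum_sum_type, polarMatrix,
      Matrix.fromRows_apply_inl, Matrix.fromRows_apply_inr, Matrix.of_apply]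
    simp only [neg_mul, Finset.sum_neg_distrib]
    ring_nf

theorem exists_eq_insertRow_dependentRow {K : Type*} [Field K] [Algebra ℂ K] {x : Fin n → K}
    {a : Matrix (Fin (m + 1)) (Fin n) K} (hJ : (jacobianAt G x).rank = p)
    (h : (polarMatrix G x a).rank < p + (m + 1)) :
    ∃ (j : Fin (m + 1)) (v : Fin p ⊕ Fin m → K),
      a = insertRow j (dependentRow G x (a.submatrix j.succAbove id) v)
        (a.submatrix j.succAbove id) := by
  obtain ⟨u, hu0, hu⟩ := Matrix.exists_vecMul_eq_zero_of_rank_lt (M := polarMatrix G x a) (by simpa)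
  have : ∃ j, u (Sum.inr j) ≠ 0 := by
    by_contra! hj
    have hJ' : LinearIndependent K (jacobianAt G x).row := by
      rw [Matrix.linearIndependent_row_iff_rank, hJ, Fintype.card_fin]
    rw [← Matrix.vecMul_injective_iff] at hJ'
    have h0 : (fun t => u (Sum.inl t)) = 0 := by
      apply hJ'
      ext l
      simpa [Matrix.vecMul, dotProduct, polarMatrix, hj] using congrFun hu l
    apply hu0
    ext (t | k)
    · exact congrFun h0 t
    · exact hj k
  obtain ⟨j, hj⟩ := this
  refine ⟨j, Sum.elim (fun t => - (u (Sum.inr j))⁻¹ * u (Sum.inl t))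
    (fun k => - (u (Sum.inr j))⁻¹ * u (Sum.inr (j.succAbove k))), ?_⟩
  have hrow : a j = dependentRow G x (a.submatrix j.succAbove id)
      (Sum.elim (fun t => - (u (Sum.inr j))⁻¹ * u (Sum.inl t))
        (fun k => - (u (Sum.inr j))⁻¹ * u (Sum.inr (j.succAbove k)))) := by
    ext l
    have := congrFun hu l
    simp only [Matrix.vecMul, dotProduct, Fintype.sum_sum_type, polarMatrix,
      Matrix.fromRows_apply_inl, Matrix.fromRows_apply_inr, Matrix.of_apply, Pi.zero_apply] at this
    rw [Fin.sum_univ_succAbove _ j] at this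
    simp only [dependentRow, Pi.add_apply, Matrix.vecMul, dotProduct, Fintype.sum_sum_type,
      polarMatrix, Matrix.fromRows_apply_inl, Matrix.fromRows_apply_inr, Matrix.of_apply,
      Matrix.submatrix_apply, id, Sum.elim_inl, Sum.elim_inr, mul_assoc, ← Finset.mul_sum]
    field_simp
    linear_combination this
  rw [← hrow]
  ext k l
  rcases Fin.eq_self_or_eq_succAbove j k with rfl | ⟨k, rfl⟩
  · exact (insertRow_same _ (a k) _ l).symm
  · exact (insertRow_succAbove j (a j) (a.submatrix j.succAbove id) k l).symm

end PolarMatrix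

section Parametrization

variable {n p m : ℕ} (G : Fin p → MvPolynomial (Fin n) ℂ) (P : Ideal (MvPolynomial (Fin n) ℂ))

/-- The coordinate ring of the product of `V(P)` with the space of pairs `(b, v)`, where `b` is an
`m × n` matrix and `v` is a vector of coefficients of a linear combination of the rows of
`polarMatrix G x b`. -/
abbrev ParamRing (p m : ℕ) : Type :=
  MvPolynomial ((Fin m × Fin n) ⊕ (Fin p ⊕ Fin m)) (MvPolynomial (Fin n) ℂ ⧸ P)

noncomputable section

/-- The coordinates on `V(P)`. -/
def paramX (p m : ℕ) : Fin n → ParamRing P p m :=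
  fun l => C (Ideal.Quotient.mk P (X l))

/-- The generic matrix. -/
def paramB (p m : ℕ) : Matrix (Fin m) (Fin n) (ParamRing P p m) :=
  Matrix.of fun k l => X (Sum.inl (k, l))

/-- The generic coefficient vector. -/
def paramV (p m : ℕ) : Fin p ⊕ Fin m → ParamRing P p m :=
  fun v => X (Sum.inr v)

/-- The parametrization of pairs consisting of a point `x` of `V(P)` and a matrix whose `j`-th row
is, modulo the other rows and the Jacobian of `G` at `x`, equal to `x`. -/
def paramHom (j : Fin (m + 1)) :
    MvPolynomial (Fin n ⊕ Fin (m + 1) × Fin n) ℂ →ₐ[ℂ] ParamRing P p m :=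
  aeval (Sum.elim (paramX P p m) fun q =>
    insertRow j (dependentRow G (paramX P p m) (paramB P p m) (paramV P p m)) (paramB P p m)
      q.1 q.2)

end

variable {G P}

theorem exists_paramRing_eval {x : Fin n → ℂ} (hx : ∀ f ∈ P, eval x f = 0)
    (b : Matrix (Fin m) (Fin n) ℂ) (v : Fin p ⊕ Fin m → ℂ) :
    ∃ ψ : ParamRing P p m →ₐ[ℂ] ℂ, ψ ∘ paramX P p m = x ∧ (paramB P p m).map ψ = b ∧
      ψ ∘ paramV P p m = v := by
  refine ⟨aevalTower (Ideal.Quotient.liftₐ P (aeval x) fun f hf => hx f hf)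
    (Sum.elim (fun q => b q.1 q.2) v), ?_, ?_, ?_⟩
  · ext l
    simp only [paramX, Function.comp_apply, aevalTower_C]
    exact (Ideal.Quotient.lift_mk _ _ _).trans (aeval_X x l)
  · ext k l
    simp [paramB]
  · ext k
    simp [paramV]

theorem apply_paramHom {x : Fin n → ℂ} {b : Matrix (Fin m) (Fin n) ℂ} {v : Fin p ⊕ Fin m → ℂ}
    {ψ : ParamRing P p m →ₐ[ℂ] ℂ} (hx : ψ ∘ paramX P p m = x) (hb : (paramB P p m).map ψ = b)
    (hv : ψ ∘ paramV P p m = v) (j : Fin (m + 1))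
    (f : MvPolynomial (Fin n ⊕ Fin (m + 1) × Fin n) ℂ) :
    ψ (paramHom G P j f) =
      eval (Sum.elim x fun q => insertRow j (dependentRow G x b v) b q.1 q.2) f := by
  rw [paramHom, ← AlgHom.comp_apply, comp_aeval, ← coe_aeval_eq_eval, RingHom.coe_coe]
  congr 2
  ext (l | ⟨k, l⟩)
  · exact congrFun hx l
  · rcases Fin.eq_self_or_eq_succAbove j k with rfl | ⟨k, rfl⟩
    · simp only [Sum.elim_inr, insertRow_same]
      have := map_dependentRow (G := G) (A := ParamRing P p m) (B := ℂ) ψ (paramX P p m)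
        (paramB P p m) (paramV P p m) l
      rwa [hx, hb, hv] at this
    · simp only [Sum.elim_inr, insertRow_succAbove]
      exact congrFun (congrFun hb k) l

theorem trdeg_paramRing [P.IsPrime] :
    Algebra.trdeg ℂ (ParamRing P p m) =
      Algebra.trdeg ℂ (MvPolynomial (Fin n) ℂ ⧸ P) + ((m * n + (p + m) : ℕ) : Cardinal) := by
  rw [← trdeg_add_eq ℂ (MvPolynomial (Fin n) ℂ ⧸ P) (A := ParamRing P p m),
    MvPolynomial.trdeg_of_isDomain]
  simp

theorem exists_det_polarMatrix_ne_zero (hm : p + m ≤ n) {x : Fin n → ℂ} {c : Fin p → Fin n}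
    (hc : ((jacobianAt G x).submatrix id c).det ≠ 0) :
    ∃ (b : Matrix (Fin m) (Fin n) ℂ) (e : Fin p ⊕ Fin m → Fin n),
      ((polarMatrix G x b).submatrix id e).det ≠ 0 := by
  classical
  have hcard : Fintype.card (Fin m) ≤ Fintype.card {l // l ∉ Set.range c} := by
    have h1 : Fintype.card (Set.range c) ≤ p := by
      simpa using Fintype.card_range_le c
    have h2 := Fintype.card_subtype_compl (fun l => l ∈ Set.range c)
    simp only [Fintype.card_fin] at h2 ⊢
    rw [h2]
    have : Fintype.card {l // l ∈ Set.range c} = Fintype.card (Set.range c) := rfl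
    omega
  obtain ⟨e⟩ := Function.Embedding.nonempty_of_card_le hcard
  refine ⟨Matrix.of fun k l => x l + if l = e k then 1 else 0, Sum.elim c fun k => (e k).1, ?_⟩
  have : (polarMatrix G x (Matrix.of fun k l => x l + if l = (e k).1 then 1 else 0)).submatrix id
      (Sum.elim c fun k => (e k).1) = Matrix.fromBlocks ((jacobianAt G x).submatrix id c)
        ((jacobianAt G x).submatrix id fun k => (e k).1) 0 (1 : Matrix (Fin m) (Fin m) ℂ) := by
    ext (i | i) (k | k)
    · simp [polarMatrix]
    · simp [polarMatrix]
    · have : c k ≠ e i := fun h => (e i).2 ⟨k, h⟩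
      simp [polarMatrix, this]
    · simp [polarMatrix, Matrix.one_apply, Subtype.val_inj, eq_comm]
  rw [this, Matrix.det_fromBlocks_zero₂₁, Matrix.det_one, mul_one]
  exact hc

/-- If `f : E → B` is such that `B` is algebraic over the range of `f`, then the transcendence
degree of `B` is at most the one of the image of `f`. -/
theorem trdeg_le_trdeg_quotient_ker_of_isAlgebraic {k E B : Type} [Field k] [CommRing E]
    [CommRing B] [IsDomain B] [Algebra k E] [Algebra k B] (f : E →ₐ[k] B)
    (h : ∀ b : B, IsAlgebraic f.range b) :
    Algebra.trdeg k B ≤ Algebra.trdeg k (E ⧸ RingHom.ker f) := by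
  have : Algebra.IsAlgebraic f.range B := ⟨h⟩
  rw [AlgEquiv.trdeg_eq (Ideal.quotientKerEquivRange f), ← trdeg_add_eq k f.range (A := B),
    trdeg_eq_zero (R := f.range), add_zero]

theorem exists_subalgebra_isAlgebraic {k B : Type*} [Field k] [CommRing B] [IsDomain B]
    [Algebra k B] (A : Subalgebra k B) :
    ∃ S : Subalgebra k B, (∀ b, b ∈ S ↔ IsAlgebraic A b) ∧ A ≤ S :=
  ⟨(Subalgebra.algebraicClosure A B).restrictScalars k, fun _ => Iff.rfl,
    fun b hb => isAlgebraic_algebraMap (⟨b, hb⟩ : A)⟩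

theorem map_det_polarMatrix {A B : Type*} [CommRing A] [Algebra ℂ A] [CommRing B] [Algebra ℂ B]
    (f : A →ₐ[ℂ] B) (x : Fin n → A) (a : Matrix (Fin m) (Fin n) A) (e : Fin p ⊕ Fin m → Fin n) :
    f ((polarMatrix G x a).submatrix id e).det =
      ((polarMatrix G (f ∘ x) (a.map f)).submatrix id e).det := by
  rw [← map_polarMatrix, AlgHom.map_det]
  rfl

theorem isAlgebraic_of_dependentRow_mem {B : Type*} [CommRing B] [IsDomain B] [Algebra ℂ B]
    (A : Subalgebra ℂ B) {x : Fin n → B} {b : Matrix (Fin m) (Fin n) B} {v : Fin p ⊕ Fin m → B}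
    (hx : ∀ l, x l ∈ A) (hb : ∀ k l, b k l ∈ A) (hw : ∀ l, dependentRow G x b v l ∈ A)
    {e : Fin p ⊕ Fin m → Fin n} (he : ((polarMatrix G x b).submatrix id e).det ≠ 0)
    (i : Fin p ⊕ Fin m) : IsAlgebraic A (v i) := by
  set M := (polarMatrix G x b).submatrix id e with hM
  have hAM (i k) : polarMatrix G x b i k ∈ A := by
    rcases i with t | i
    · simp only [polarMatrix, jacobianAt, Matrix.fromRows_apply_inl, Matrix.of_apply]
      have hle : Algebra.adjoin ℂ (Set.range x) ≤ A := by
        refine Algebra.adjoin_le ?_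
        rintro _ ⟨l, rfl⟩
        exact hx l
      rw [Algebra.adjoin_range_eq_range_aeval] at hle
      exact hle ⟨_, rfl⟩
    · exact A.sub_mem (hb _ _) (hx _)
  let N : Matrix (Fin p ⊕ Fin m) (Fin p ⊕ Fin m) A := Matrix.of fun i k => ⟨M i k, hAM _ _⟩
  have hMN : M = A.val.mapMatrix N := rfl
  have hd : (N.det : B) = M.det := by
    rw [hMN, ← AlgHom.map_det]
    rfl
  have hadj : ∀ i k, M.adjugate i k ∈ A := by
    intro i k
    rw [hMN, ← AlgHom.map_adjugate]
    exact Subtype.property _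
  have h1 : Matrix.vecMul (Matrix.vecMul v M) M.adjugate i = M.det * v i := by
    rw [Matrix.vecMul_vecMul, Matrix.mul_adjugate, Matrix.vecMul_smul, Matrix.vecMul_one]
    rfl
  have h2 : Matrix.vecMul (Matrix.vecMul v M) M.adjugate i ∈ A := by
    rw [Matrix.vecMul, dotProduct]
    refine A.sum_mem (f := fun k => Matrix.vecMul v M k * M.adjugate k i) fun k _ =>
      A.mul_mem ?_ (hadj _ _)
    have : Matrix.vecMul v M k = dependentRow G x b v (e k) - x (e k) := by
      simp [dependentRow, hM, Matrix.vecMul, dotProduct]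
    rw [this]
    exact A.sub_mem (hw _) (hx _)
  refine ⟨Polynomial.C N.det * Polynomial.X - Polynomial.C ⟨_, h2⟩, ?_, ?_⟩
  · intro h0
    have := congrArg (fun q => Polynomial.coeff q 1) h0
    simp only [Polynomial.coeff_sub, Polynomial.coeff_C_mul, Polynomial.coeff_X_one, mul_one,
      Polynomial.coeff_C_succ, sub_zero, Polynomial.coeff_zero] at this
    apply he
    rw [← hd, this]
    rfl
  · simp only [map_sub, map_mul, Polynomial.aeval_C, Polynomial.aeval_X]
    rw [Subalgebra.algebraMap_def, Subalgebra.algebraMap_def]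
    change (N.det : B) * v i - Matrix.vecMul (Matrix.vecMul v M) M.adjugate i = 0
    rw [hd, h1, sub_self]

theorem paramRing_mem {S : Subalgebra ℂ (ParamRing P p m)} (hx : ∀ l, paramX P p m l ∈ S)
    (hb : ∀ k l, paramB P p m k l ∈ S) (hv : ∀ i, paramV P p m i ∈ S) (q : ParamRing P p m) :
    q ∈ S := by
  induction q using MvPolynomial.induction_on with
  | C r =>
    obtain ⟨f, rfl⟩ := Ideal.Quotient.mk_surjective r
    induction f using MvPolynomial.induction_on with
    | C a => exact S.algebraMap_mem a
    | add f g hf hg =>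
      rw [map_add, map_add]
      exact add_mem hf hg
    | mul_X f l hf =>
      rw [map_mul, map_mul]
      exact mul_mem hf (hx l)
  | add f g hf hg => exact add_mem hf hg
  | mul_X f i hf =>
    refine mul_mem hf ?_
    rcases i with ⟨k, l⟩ | i
    · exact hb k l
    · exact hv i

theorem trdeg_paramRing_le_trdeg_quotient_ker [P.IsPrime] (hm : p + m ≤ n) {x : Fin n → ℂ}
    (hx : ∀ f ∈ P, eval x f = 0) {c : Fin p → Fin n}
    (hc : ((jacobianAt G x).submatrix id c).det ≠ 0) (j : Fin (m + 1)) :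
    Algebra.trdeg ℂ (ParamRing P p m) ≤
      Algebra.trdeg ℂ (MvPolynomial (Fin n ⊕ Fin (m + 1) × Fin n) ℂ ⧸
        RingHom.ker (paramHom (p := p) G P j)) := by
  obtain ⟨b, e, he⟩ := exists_det_polarMatrix_ne_zero (m := m) hm hc
  obtain ⟨ψ, hψx, hψb, -⟩ := exists_paramRing_eval (p := p) (m := m) hx b 0
  have hdet : ((polarMatrix G (paramX P p m) (paramB P p m)).submatrix id e).det ≠ 0 := by
    intro h0
    apply he
    have h1 := map_det_polarMatrix (G := G) (A := ParamRing P p m) (B := ℂ) ψ (paramX P p m)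
      (paramB P p m) e
    rwa [h0, map_zero, hψx, hψb, eq_comm] at h1
  refine trdeg_le_trdeg_quotient_ker_of_isAlgebraic (B := ParamRing P p m) _ fun q => ?_
  have hAx (l) : paramX P p m l ∈ (paramHom (p := p) G P j).range :=
    ⟨X (Sum.inl l), by simp [paramHom]⟩
  have hAb (k l) : paramB P p m k l ∈ (paramHom (p := p) G P j).range :=
    ⟨X (Sum.inr (j.succAbove k, l)), by simp [paramHom]⟩
  have hAw (l) : dependentRow G (paramX P p m) (paramB P p m) (paramV P p m) l ∈
      (paramHom (p := p) G P j).range :=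
    ⟨X (Sum.inr (j, l)), by simp [paramHom]⟩
  have hv := isAlgebraic_of_dependentRow_mem (B := ParamRing P p m) _ hAx hAb hAw hdet
  obtain ⟨S, hS, hSA⟩ := exists_subalgebra_isAlgebraic (B := ParamRing P p m)
    (paramHom (p := p) G P j).range
  exact (hS q).mp (paramRing_mem (fun l => hSA (hAx l)) (fun k l => hSA (hAb k l))
    (fun i => (hS _).mpr (hv i)) q)

end Parametrization

section UpperBound

theorem trdeg_le_of_forall_embedding {k B : Type u} [Field k] [CommRing B] [IsDomain B]
    [Algebra k B] {n m : ℕ} {x : Fin n → B} (hx : Algebra.adjoin k (Set.range x) = ⊤)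
    (h : ∀ L : Fin (m + 1) ↪ Fin n, ¬ AlgebraicIndependent k (x ∘ L)) :
    Algebra.trdeg k B ≤ m := by
  by_contra! hlt
  have : Algebra.IsAlgebraic (Algebra.adjoin k (Set.range x)) B :=
    ⟨fun q => isAlgebraic_algebraMap (⟨q, hx ▸ trivial⟩ : Algebra.adjoin k (Set.range x))⟩
  obtain ⟨t, hts, ht⟩ := exists_isTranscendenceBasis_subset (R := k) (Set.range x)
  have hcard : Cardinal.lift.{u} (Cardinal.mk (Fin (m + 1))) ≤
      Cardinal.lift.{0} (Cardinal.mk t) := by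
    rw [ht.cardinalMk_eq_trdeg, Cardinal.mk_fin, Cardinal.lift_natCast, Cardinal.lift_id'.{0, u}]
    push_cast
    exact Cardinal.natCast_add_one_le_iff.mpr hlt
  obtain ⟨e⟩ := Cardinal.lift_mk_le'.mp hcard
  choose L hL using fun i => hts (e i).2
  have hLinj : Function.Injective L := fun i k hik => by
    apply e.injective
    apply Subtype.ext
    rw [← hL, ← hL, hik]
  refine h ⟨L, hLinj⟩ ?_
  convert ht.1.comp e e.injective using 1
  ext i
  exact hL i

theorem trdeg_quotient_le_of_forall_embedding {n m : ℕ} {P : Ideal (MvPolynomial (Fin n) ℂ)}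
    [P.IsPrime] (h : ∀ L : Fin (m + 1) ↪ Fin n,
      ∃ f : MvPolynomial (Fin (m + 1)) ℂ, f ≠ 0 ∧ rename L f ∈ P) :
    Algebra.trdeg ℂ (MvPolynomial (Fin n) ℂ ⧸ P) ≤ m := by
  have hmk : aeval (fun l : Fin n => Ideal.Quotient.mkₐ ℂ P (X l)) = Ideal.Quotient.mkₐ ℂ P := by
    ext l
    simp
  refine trdeg_le_of_forall_embedding (x := fun l => Ideal.Quotient.mkₐ ℂ P (X l)) ?_ fun L hL => ?_
  · rw [Algebra.adjoin_range_eq_range_aeval, hmk, AlgHom.range_eq_top]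
    exact Ideal.Quotient.mkₐ_surjective ℂ P
  · obtain ⟨f, hf0, hf⟩ := h L
    apply hf0
    rw [algebraicIndependent_iff] at hL
    apply hL
    rw [← aeval_rename, hmk]
    exact Ideal.Quotient.eq_zero_iff_mem.mpr hf

theorem eval_map_sumAlgEquiv {σ τ : Type*} (x : σ → ℂ) (a : τ → ℂ) (f : MvPolynomial (σ ⊕ τ) ℂ) :
    eval x (map (eval a) (sumAlgEquiv ℂ σ τ f)) = eval (Sum.elim x a) f := by
  induction f using MvPolynomial.induction_on with
  | C r => simp
  | add f g hf hg => simp [hf, hg]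
  | mul_X f i hf =>
    rw [map_mul, map_mul, map_mul, map_mul, hf]
    congr 1
    rcases i with i | i <;> simp

variable {n p m : ℕ} {G : Fin p → MvPolynomial (Fin n) ℂ} {P : Ideal (MvPolynomial (Fin n) ℂ)}

theorem not_algebraicIndependent_paramHom [P.IsPrime] {d : ℕ} (hd : d + p ≤ n)
    (htr : Algebra.trdeg ℂ (MvPolynomial (Fin n) ℂ ⧸ P) = d) (j : Fin (m + 1))
    (L : Fin (m + 1) → Fin n) :
    ¬ AlgebraicIndependent ℂ fun i : Fin (m + 1) ⊕ Fin (m + 1) × Fin n =>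
      paramHom G P j (X (Sum.map L id i)) := by
  intro h
  have := AlgebraicIndependent.cardinalMk_le_trdeg (A := ParamRing P p m) h
  rw [trdeg_paramRing, htr, Cardinal.mk_fintype] at this
  simp only [Fintype.card_sum, Fintype.card_prod, Fintype.card_fin] at this
  have h2 : m + 1 + (m + 1) * n ≤ d + (m * n + (p + m)) := by exact_mod_cast this
  have h3 : (m + 1) * n = m * n + n := by ring
  omega

/-- For a generic matrix `a`, the coordinates indexed by `L` of the points of `V(P)` at which the
`j`-th row of `a` is dependent satisfy a nontrivial polynomial relation. -/
theorem exists_relation_of_eval_ne_zero [P.IsPrime] {d : ℕ} (hd : d + p ≤ n)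
    (htr : Algebra.trdeg ℂ (MvPolynomial (Fin n) ℂ ⧸ P) = d) (j : Fin (m + 1))
    (L : Fin (m + 1) → Fin n) :
    ∃ c : MvPolynomial (Fin (m + 1) × Fin n) ℂ, c ≠ 0 ∧
      ∀ a : Matrix (Fin (m + 1)) (Fin n) ℂ, eval (fun q => a q.1 q.2) c ≠ 0 →
        ∃ f : MvPolynomial (Fin (m + 1)) ℂ, f ≠ 0 ∧ ∀ x : Fin n → ℂ, (∀ g ∈ P, eval x g = 0) →
          ∀ b v, a = insertRow j (dependentRow G x b v) b → eval (x ∘ L) f = 0 := by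
  have h := not_algebraicIndependent_paramHom (G := G) hd htr j L
  rw [algebraicIndependent_iff] at h
  push Not at h
  obtain ⟨f, hf, hf0⟩ := h
  have hs0 : sumAlgEquiv ℂ _ _ f ≠ 0 := by simpa using hf0
  obtain ⟨u, hu⟩ := MvPolynomial.ne_zero_iff.mp hs0
  refine ⟨_, hu, fun a ha => ⟨map (eval fun q => a q.1 q.2) (sumAlgEquiv ℂ _ _ f), ?_, ?_⟩⟩
  · rw [MvPolynomial.ne_zero_iff]
    exact ⟨u, by rwa [coeff_map]⟩
  · intro x hx b v hab
    obtain ⟨ψ, hψx, hψb, hψv⟩ := exists_paramRing_eval (p := p) (m := m) hx b v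
    rw [eval_map_sumAlgEquiv]
    have h1 := apply_paramHom (G := G) hψx hψb hψv j (rename (Sum.map L id) f)
    have h2 : paramHom G P j (rename (Sum.map L id) f) = 0 := by
      rw [← hf, ← AlgHom.comp_apply]
      congr 1
      ext i
      simp
    rw [h2, map_zero, ← hab, eval_rename] at h1
    rw [h1]
    congr 2
    ext (i | i) <;> rfl

end UpperBound

section LowerBound

variable {n p m : ℕ} (G : Fin p → MvPolynomial (Fin n) ℂ) (P₀ : Ideal (MvPolynomial (Fin n) ℂ))
  (c : Fin p → Fin n) (a : Matrix (Fin (m + 1)) (Fin n) ℂ)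

/-- The points of `V(P₀)` at which the minor of the Jacobian indexed by `c` does not vanish and at
which `polarMatrix G x a` does not have maximal rank. -/
def polarPiece : Set (Fin n → ℂ) :=
  {x | (∀ f ∈ P₀, eval x f = 0) ∧ ((jacobianAt G x).submatrix id c).det ≠ 0 ∧
    (polarMatrix G x a).rank < p + (m + 1)}

/-- The points of `polarPiece G P₀ c a` at which the `j`-th row of `a` depends on the others. -/
def polarPieceRow (j : Fin (m + 1)) : Set (Fin n → ℂ) :=
  {x | x ∈ polarPiece G P₀ c a ∧ ∃ b v, a = insertRow j (dependentRow G x b v) b}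

/-- The minor of the Jacobian indexed by `c`. -/
noncomputable def jacobianMinor : MvPolynomial (Fin n) ℂ :=
  ((jacobianAt G (X : Fin n → MvPolynomial (Fin n) ℂ)).submatrix id c).det

variable {G P₀ c a}

theorem eval_jacobianMinor (x : Fin n → ℂ) :
    eval x (jacobianMinor G c) = ((jacobianAt G x).submatrix id c).det := by
  have h := map_jacobianAt (G := G) (aeval x : MvPolynomial (Fin n) ℂ →ₐ[ℂ] ℂ) X
  have hx : (aeval x : MvPolynomial (Fin n) ℂ →ₐ[ℂ] ℂ) ∘ X = x := by
    ext l
    simp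
  rw [hx] at h
  rw [← h, jacobianMinor, ← coe_aeval_eq_eval, RingHom.coe_coe, AlgHom.map_det]
  rfl

theorem jacobianMinor_notMem {P : Ideal (MvPolynomial (Fin n) ℂ)}
    (hP : P ∈ (vanishingIdeal ℂ (polarPiece G P₀ c a)).minimalPrimes) :
    jacobianMinor G c ∉ P := by
  intro h
  obtain ⟨y, hy, hy'⟩ := Ideal.exists_mul_mem_of_mem_minimalPrimes hP h
  refine hy (mem_vanishingIdeal_iff.mpr fun x hx => ?_)
  have h1 := mem_vanishingIdeal_iff.mp hy' x hx
  rw [map_mul, mul_eq_zero] at h1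
  refine h1.resolve_left fun h2 => hx.2.1 ?_
  rw [← eval_jacobianMinor]
  exact h2

theorem jacobianAt_rank_of_det_ne_zero {x : Fin n → ℂ}
    (h : ((jacobianAt G x).submatrix id c).det ≠ 0) : (jacobianAt G x).rank = p := by
  refine le_antisymm (by simpa using Matrix.rank_le_card_height (jacobianAt G x)) ?_
  have h1 := Matrix.rank_of_isUnit _ ((Matrix.isUnit_iff_isUnit_det _).mpr h.isUnit)
  rw [Fintype.card_fin] at h1
  exact h1.symm.le.trans (Matrix.rank_submatrix_le _ _ _)

theorem eval_aeval_sumElim (x : Fin n → ℂ) (f : MvPolynomial (Fin n ⊕ Fin (m + 1) × Fin n) ℂ) :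
    eval x (aeval (Sum.elim X fun q => C (a q.1 q.2)) f) =
      eval (Sum.elim x fun q => a q.1 q.2) f := by
  rw [← coe_aeval_eq_eval, ← coe_aeval_eq_eval, RingHom.coe_coe, RingHom.coe_coe,
    ← AlgHom.comp_apply]
  congr 1
  ext (i | i) <;> simp

theorem le_trdeg_quotient_of_mem_minimalPrimes [P₀.IsPrime]
    {d : ℕ} (hd : d + p = n) (hm : p + m ≤ n)
    (htr : Algebra.trdeg ℂ (MvPolynomial (Fin n) ℂ ⧸ P₀) = d) {j : Fin (m + 1)}
    {P : Ideal (MvPolynomial (Fin n) ℂ)}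
    (hP : P ∈ (vanishingIdeal ℂ (polarPiece G P₀ c a)).minimalPrimes)
    (hj : vanishingIdeal ℂ (polarPieceRow G P₀ c a j) ≤ P) :
    (m : Cardinal) ≤ Algebra.trdeg ℂ (MvPolynomial (Fin n) ℂ ⧸ P) := by
  classical
  have hPp : P.IsPrime := hP.1.1
  have hδ := jacobianMinor_notMem hP
  let ev : MvPolynomial (Fin n ⊕ Fin (m + 1) × Fin n) ℂ →ₐ[ℂ] MvPolynomial (Fin n) ℂ :=
    aeval (Sum.elim X fun q => C (a q.1 q.2))
  let ι : MvPolynomial (Fin n) ℂ →ₐ[ℂ] MvPolynomial (Fin n ⊕ Fin (m + 1) × Fin n) ℂ :=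
    rename Sum.inl
  have hevι (f) : ev (ι f) = f := by
    rw [← AlgHom.comp_apply]
    conv_rhs => rw [← AlgHom.id_apply (R := ℂ) f]
    congr 1
    ext l
    simp [ev, ι]
  let s : Finset (MvPolynomial (Fin n ⊕ Fin (m + 1) × Fin n) ℂ) :=
    Finset.univ.image fun q : Fin (m + 1) × Fin n => X (Sum.inr q) - C (a q.1 q.2)
  have hs : s.card ≤ (m + 1) * n := by
    refine Finset.card_image_le.trans ?_
    simp
  set φ := paramHom (p := p) G P₀ j with hφ
  have hmin : P.comap ev ∈ (RingHom.ker φ ⊔ Ideal.span (s : Set _)).minimalPrimes := by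
    refine ⟨⟨Ideal.comap_isPrime ev P, ?_⟩, ?_⟩
    · refine sup_le (fun f hf => ?_) (Ideal.span_le.mpr ?_)
      · refine hj (mem_vanishingIdeal_iff.mpr fun x hx => ?_)
        obtain ⟨hx, b, v, hab⟩ := hx
        obtain ⟨ψ, hψx, hψb, hψv⟩ := exists_paramRing_eval (p := p) (m := m) hx.1 b v
        have h1 := apply_paramHom (G := G) hψx hψb hψv j f
        rw [← hφ, (RingHom.mem_ker).mp hf, map_zero, ← hab, ← eval_aeval_sumElim] at h1
        exact h1.symm
      · intro f hf
        obtain ⟨q, -, rfl⟩ := Finset.mem_image.mp hf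
        have : ev (X (Sum.inr q) - C (a q.1 q.2)) = 0 := by simp [ev]
        rw [SetLike.mem_coe, Ideal.mem_comap]
        exact this ▸ P.zero_mem
    · rintro Q ⟨hQp, hQ⟩ hQP
      have hQ1 := le_sup_left.trans hQ
      have hcong (g) : ι (ev g) - g ∈ Q := by
        have h1 : (Ideal.Quotient.mkₐ ℂ Q).comp (ι.comp ev) = Ideal.Quotient.mkₐ ℂ Q := by
          ext (l | q)
          · simp [ι, ev]
          · have h2 : X (Sum.inr q) - C (a q.1 q.2) ∈ Q := by
              refine hQ (Ideal.mem_sup_right (Ideal.subset_span ?_))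
              exact Finset.mem_coe.mpr (Finset.mem_image_of_mem _ (Finset.mem_univ q))
            have h3 := Ideal.Quotient.eq.mpr h2
            simp only [AlgHom.comp_apply, ι, ev, aeval_X, Sum.elim_inr, rename_C]
            exact h3.symm
        exact Ideal.Quotient.eq.mp (DFunLike.congr_fun h1 g)
      have hmem (g) (hg : g ∈ Q) : ev g ∈ Q.comap ι := by
        have := Q.add_mem (hcong g) hg
        rwa [sub_add_cancel] at this
      have hmem' (g) (hg : ev g ∈ Q.comap ι) : g ∈ Q := by
        have := Q.sub_mem hg (hcong g)
        rwa [sub_sub_cancel] at this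
      have hP'P : Q.comap ι ≤ P := fun f hf => by
        have : ev (ι f) ∈ P := hQP hf
        rwa [hevι] at this
      have hP' : (Q.comap ι).IsPrime := Ideal.comap_isPrime ι Q
      have hPP' : P ≤ Q.comap ι := by
        refine hP.2 ⟨hP', fun f hf => ?_⟩ hP'P
        have hfδ : f * jacobianMinor G c ∈ Q.comap ι := by
          rw [← hP'.radical, ← vanishingIdeal_zeroLocus_eq_radical (K := ℂ)]
          refine mem_vanishingIdeal_iff.mpr fun x hx => ?_
          rw [map_mul, mul_eq_zero]
          by_cases hxδ : aeval x (jacobianMinor G c) = 0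
          · exact Or.inr hxδ
          left
          have hdet : ((jacobianAt G x).submatrix id c).det ≠ 0 := by
            rw [← eval_jacobianMinor]
            exact hxδ
          refine mem_vanishingIdeal_iff.mp hf x ⟨fun g hg => ?_, hdet, ?_⟩
          · refine mem_zeroLocus_iff.mp hx g (hQ1 (RingHom.mem_ker.mpr ?_))
            have : φ.comp ι = ((Algebra.ofId (MvPolynomial (Fin n) ℂ ⧸ P₀)
                (ParamRing P₀ p m)).restrictScalars ℂ).comp (Ideal.Quotient.mkₐ ℂ P₀) := by
              ext l
              simp [φ, ι, paramHom, paramX, Algebra.ofId_apply]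
            change (φ.comp ι) g = 0
            rw [this, AlgHom.comp_apply]
            have h0 : Ideal.Quotient.mkₐ ℂ P₀ g = 0 := Ideal.Quotient.eq_zero_iff_mem.mpr hg
            rw [h0, map_zero]
          · by_contra hrank
            have hli : LinearIndependent ℂ (polarMatrix G x a).row := by
              rw [Matrix.linearIndependent_row_iff_rank]
              refine le_antisymm (Matrix.rank_le_card_height _) ?_
              simpa using hrank
            obtain ⟨e, he⟩ := Matrix.exists_det_submatrix_ne_zero hli
            apply he
            let D : MvPolynomial (Fin n ⊕ Fin (m + 1) × Fin n) ℂ :=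
              ((polarMatrix G (fun l => X (Sum.inl l))
                (Matrix.of fun k l => X (Sum.inr (k, l)))).submatrix id e).det
            have hD : D ∈ Q := by
              refine hQ1 (RingHom.mem_ker.mpr ?_)
              have h1 := map_det_polarMatrix (G := G) (B := ParamRing P₀ p m) φ
                (fun l => X (Sum.inl l)) (Matrix.of fun k l => X (Sum.inr (k, l))) e
              refine h1.trans ?_
              have h2 : φ ∘ (fun l => X (Sum.inl l)) = paramX P₀ p m := by
                ext1 l
                simp [φ, paramHom]
              have h3 : (Matrix.of fun k l => X (Sum.inr (k, l))).map φ =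
                  insertRow j (dependentRow G (paramX P₀ p m) (paramB P₀ p m) (paramV P₀ p m))
                    (paramB P₀ p m) := by
                ext1 k l
                simp [φ, paramHom]
              rw [h2, h3]
              exact det_polarMatrix_insertRow (A := ParamRing P₀ p m) _ _ _ _ _
            have h1 := mem_zeroLocus_iff.mp hx _ (hmem D hD)
            have h2 := map_det_polarMatrix (G := G)
              (aeval (Sum.elim x fun q => a q.1 q.2) :
                MvPolynomial (Fin n ⊕ Fin (m + 1) × Fin n) ℂ →ₐ[ℂ] ℂ)
              (fun l => X (Sum.inl l)) (Matrix.of fun k l => X (Sum.inr (k, l))) e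
            have h3 : aeval (Sum.elim x fun q => a q.1 q.2) D = 0 := by
              rw [← h1]
              exact (eval_aeval_sumElim x D).symm
            rw [h3] at h2
            rw [h2]
            congr 3
            · ext l
              simp
            · ext k l
              simp
        exact (hP'.mem_or_mem hfδ).resolve_right fun h => hδ (hP'P h)
      exact fun g hg => hmem' g (hPP' hg)
  have hker : (RingHom.ker φ).IsPrime := RingHom.ker_isPrime φ
  obtain ⟨x₀, hx₀⟩ : (polarPieceRow G P₀ c a j).Nonempty := by
    by_contra h
    rw [Set.not_nonempty_iff_eq_empty] at h
    apply hPp.ne_top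
    rw [eq_top_iff, ← vanishingIdeal_empty (K := ℂ), ← h]
    exact hj
  have h1 := trdeg_quotient_le_trdeg_quotient_add_card (k := ℂ) s hmin
  have h2 := trdeg_paramRing_le_trdeg_quotient_ker hm hx₀.1.1 hx₀.1.2.1 j
  have h3 : Algebra.trdeg ℂ (MvPolynomial (Fin n ⊕ Fin (m + 1) × Fin n) ℂ ⧸ P.comap ev) ≤
      Algebra.trdeg ℂ (MvPolynomial (Fin n) ℂ ⧸ P) :=
    trdeg_le_of_injective (Ideal.quotientMapₐ P ev le_rfl) Ideal.quotientMap_injective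
  obtain ⟨t, -, ht⟩ := exists_ringKrullDim_eq_and_trdeg_eq ℂ (MvPolynomial (Fin n) ℂ ⧸ P)
  rw [trdeg_paramRing, htr] at h2
  have h4 := h2.trans (h1.trans (add_le_add_left h3 _))
  rw [ht] at h4 ⊢
  norm_cast at h4 ⊢
  have h5 : (m + 1) * n = m * n + n := by ring
  omega

end LowerBound

section PureDimension

variable {n p m : ℕ} {G : Fin p → MvPolynomial (Fin n) ℂ}

/-- The regular points of `V(G)` at which `polarMatrix G x a` does not have maximal rank. -/
def polarSet (G : Fin p → MvPolynomial (Fin n) ℂ) (a : Matrix (Fin (m + 1)) (Fin n) ℂ) :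
    Set (Fin n → ℂ) :=
  {x | (∀ k, eval x (G k) = 0) ∧ (jacobianAt G x).rank = p ∧
    (polarMatrix G x a).rank < p + (m + 1)}

theorem trdeg_quotient_of_ringKrullDim_eq {P : Ideal (MvPolynomial (Fin n) ℂ)} [P.IsPrime] {d : ℕ}
    (h : ringKrullDim (MvPolynomial (Fin n) ℂ ⧸ P) = (d : WithBot (WithTop ℕ))) :
    Algebra.trdeg ℂ (MvPolynomial (Fin n) ℂ ⧸ P) = d := by
  obtain ⟨t, ht, ht'⟩ := exists_ringKrullDim_eq_and_trdeg_eq ℂ (MvPolynomial (Fin n) ℂ ⧸ P)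
  have h' : (t : WithBot ℕ∞) = (d : WithBot ℕ∞) := ht.symm.trans h
  have : t = d := by exact_mod_cast h'
  rw [ht', this]

theorem ringKrullDim_quotient_of_trdeg_eq {P : Ideal (MvPolynomial (Fin n) ℂ)} [P.IsPrime] {d : ℕ}
    (h : Algebra.trdeg ℂ (MvPolynomial (Fin n) ℂ ⧸ P) = d) :
    ringKrullDim (MvPolynomial (Fin n) ℂ ⧸ P) = (d : WithBot (WithTop ℕ)) := by
  obtain ⟨t, ht, ht'⟩ := exists_ringKrullDim_eq_and_trdeg_eq ℂ (MvPolynomial (Fin n) ℂ ⧸ P)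
  rw [ht'] at h
  have : t = d := by exact_mod_cast h
  rw [ht, this]
  rfl

/-- A generic matrix `a` is such that all components of `polarSet G a` have dimension `m`. -/
theorem exists_forall_ringKrullDim_polarSet_eq {d : ℕ} (hd : d + p = n) (hm : p + m ≤ n)
    (hS : ∀ P ∈ (vanishingIdeal ℂ {x : Fin n → ℂ | ∀ k, eval x (G k) = 0}).minimalPrimes,
      ringKrullDim (MvPolynomial (Fin n) ℂ ⧸ P) = (d : WithBot (WithTop ℕ))) :
    ∃ g : MvPolynomial (Fin (m + 1) × Fin n) ℂ, g ≠ 0 ∧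
      ∀ a : Matrix (Fin (m + 1)) (Fin n) ℂ, eval (fun q => a q.1 q.2) g ≠ 0 →
        ∀ P ∈ (vanishingIdeal ℂ (polarSet G a)).minimalPrimes,
          ringKrullDim (MvPolynomial (Fin n) ℂ ⧸ P) = (m : WithBot (WithTop ℕ)) := by
  classical
  set I := vanishingIdeal ℂ {x : Fin n → ℂ | ∀ k, eval x (G k) = 0} with hI
  have hfin : Finite I.minimalPrimes := Ideal.finite_minimalPrimes_of_isNoetherianRing _ I
  have := Fintype.ofFinite I.minimalPrimes
  have hprime (P : I.minimalPrimes) : P.1.IsPrime := P.2.1.1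
  have htr (P : I.minimalPrimes) : Algebra.trdeg ℂ (MvPolynomial (Fin n) ℂ ⧸ P.1) = d :=
    trdeg_quotient_of_ringKrullDim_eq (hS P.1 P.2)
  choose g hg0 hg using fun q : I.minimalPrimes × Fin (m + 1) × (Fin (m + 1) ↪ Fin n) =>
    exists_relation_of_eval_ne_zero (G := G) hd.le (htr q.1) q.2.1 q.2.2
  refine ⟨∏ q, g q, Finset.prod_ne_zero_iff.mpr fun q _ => hg0 q, fun a ha P hP => ?_⟩
  have hPp : P.IsPrime := hP.1.1
  have hle : Finset.univ.inf (fun q : I.minimalPrimes × (Fin p → Fin n) × Fin (m + 1) =>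
      vanishingIdeal ℂ (polarPieceRow G q.1.1 q.2.1 a q.2.2)) ≤ P := by
    refine le_trans (fun f hf => ?_) hP.1.2
    refine mem_vanishingIdeal_iff.mpr fun x hx => ?_
    have hxI : I ≤ vanishingIdeal ℂ {x} := vanishingIdeal_anti_mono (by simpa using hx.1)
    obtain ⟨P₀, hP₀, hP₀x⟩ := Ideal.exists_minimalPrimes_le hxI
    obtain ⟨c, hc⟩ := Matrix.exists_det_submatrix_ne_zero
      (Matrix.linearIndependent_row_iff_rank.mpr (hx.2.1.trans (Fintype.card_fin p).symm))
    obtain ⟨j, v, hjv⟩ := exists_eq_insertRow_dependentRow hx.2.1 hx.2.2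
    have hf' := (Finset.inf_le (f := fun q : I.minimalPrimes × (Fin p → Fin n) × Fin (m + 1) =>
      vanishingIdeal ℂ (polarPieceRow G q.1.1 q.2.1 a q.2.2))
      (Finset.mem_univ (⟨P₀, hP₀⟩, c, j))) hf
    exact mem_vanishingIdeal_iff.mp hf' x ⟨⟨fun f hf =>
      mem_vanishingIdeal_iff.mp (hP₀x hf) x rfl, hc, hx.2.2⟩, _, v, hjv⟩
  obtain ⟨⟨P₀, c, j⟩, -, hj⟩ := hPp.inf_le'.mp hle
  dsimp only at hj
  have hsub : polarPiece G P₀.1 c a ⊆ polarSet G a := fun x hx => by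
    refine ⟨fun k => hx.1 _ (P₀.2.1.2 ?_), jacobianAt_rank_of_det_ne_zero hx.2.1, hx.2.2⟩
    exact mem_vanishingIdeal_iff.mpr fun y hy => hy k
  have hsub' : polarPieceRow G P₀.1 c a j ⊆ polarPiece G P₀.1 c a := fun x hx => hx.1
  have hP' : P ∈ (vanishingIdeal ℂ (polarPiece G P₀.1 c a)).minimalPrimes :=
    ⟨⟨hPp, (vanishingIdeal_anti_mono hsub').trans hj⟩, fun Q hQ hQP =>
      hP.2 ⟨hQ.1, (vanishingIdeal_anti_mono hsub).trans hQ.2⟩ hQP⟩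
  refine ringKrullDim_quotient_of_trdeg_eq (le_antisymm ?_ ?_)
  · refine trdeg_quotient_le_of_forall_embedding fun L => ?_
    have haL : eval (fun q => a q.1 q.2) (g (P₀, j, L)) ≠ 0 := by
      rw [map_prod] at ha
      exact Finset.prod_ne_zero_iff.mp ha _ (Finset.mem_univ _)
    obtain ⟨f, hf0, hf⟩ := hg (P₀, j, L) a haL
    refine ⟨f, hf0, hj (mem_vanishingIdeal_iff.mpr ?_)⟩
    rintro x ⟨hx, b, v, hab⟩
    rw [aeval_rename]
    exact hf x hx.1 b v hab
  · exact le_trdeg_quotient_of_mem_minimalPrimes hd hm (htr P₀) hP' hj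

end PureDimension

section RealPoints

open Topology Filter in
/-- Near a point at which `f` is a submersion, the fibre of `f` is contained in a preconnected
subset of this fibre. -/
theorem HasStrictFDerivAt.exists_isPreconnected_fiber {E F : Type*} [NormedAddCommGroup E]
    [NormedSpace ℝ E] [CompleteSpace E] [NormedAddCommGroup F] [NormedSpace ℝ F]
    [FiniteDimensional ℝ F] {f : E → F} {f' : E →L[ℝ] F} {a : E} (hf : HasStrictFDerivAt f f' a)
    (hf' : (f' : E →ₗ[ℝ] F).range = ⊤) :
    ∃ N ⊆ {y | f y = f a}, a ∈ N ∧ IsPreconnected N ∧ ∀ᶠ y in 𝓝 a, f y = f a → y ∈ N := by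
  let Φ := hf.implicitToOpenPartialHomeomorph f f' hf'
  have hfst (x) : (Φ x).1 = f x := hf.implicitToOpenPartialHomeomorph_fst hf' x
  have hself : Φ a = (f a, 0) := hf.implicitToOpenPartialHomeomorph_self hf'
  have ha : a ∈ Φ.source := hf.mem_implicitToOpenPartialHomeomorph_source hf'
  have htgt : Φ.target ∈ 𝓝 (f a, (0 : (f' : E →ₗ[ℝ] F).ker)) :=
    Φ.open_target.mem_nhds (hself ▸ Φ.map_source ha)
  obtain ⟨ε, hε, hball⟩ := Metric.mem_nhds_iff.mp htgt
  have hmem {b : (f' : E →ₗ[ℝ] F).ker} (hb : b ∈ Metric.ball 0 ε) : (f a, b) ∈ Φ.target := by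
    apply hball
    rw [← ball_prod_same]
    exact ⟨Metric.mem_ball_self hε, hb⟩
  refine ⟨(fun b => Φ.symm (f a, b)) '' Metric.ball 0 ε, ?_, ?_, ?_, ?_⟩
  · rintro _ ⟨b, hb, rfl⟩
    change f (Φ.symm (f a, b)) = f a
    rw [← hfst, Φ.right_inv (hmem hb)]
  · refine ⟨0, Metric.mem_ball_self hε, ?_⟩
    dsimp only
    rw [← hself, Φ.left_inv ha]
  · refine (convex_ball _ _).isPreconnected.image _ ?_
    exact Φ.continuousOn_symm.comp (by fun_prop) fun b hb => hmem hb
  · have h1 : ∀ᶠ y in 𝓝 a, (Φ y).2 ∈ Metric.ball 0 ε := by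
      have hc : ContinuousAt (fun y => (Φ y).2) a := (Φ.continuousAt ha).snd
      refine hc.eventually_mem (Metric.isOpen_ball.mem_nhds ?_)
      rw [hself]
      exact Metric.mem_ball_self hε
    filter_upwards [h1, Φ.open_source.mem_nhds ha] with y hy hys hya
    refine ⟨_, hy, ?_⟩
    dsimp only
    rw [← hya, ← hfst, Prod.mk.eta, Φ.left_inv hys]

theorem MvPolynomial.hasStrictFDerivAt_aeval {n : ℕ} (f : MvPolynomial (Fin n) ℚ)
    (x : EuclideanSpace ℝ (Fin n)) :
    HasStrictFDerivAt (fun y : EuclideanSpace ℝ (Fin n) => aeval (fun l => y l) f)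
      (∑ l, aeval (fun l => x l) (pderiv l f) •
        (EuclideanSpace.proj l : EuclideanSpace ℝ (Fin n) →L[ℝ] ℝ)) x := by
  induction f using MvPolynomial.induction_on with
  | C r =>
    simp only [algHom_C, pderiv_C, map_zero, zero_smul, Finset.sum_const_zero]
    exact hasStrictFDerivAt_const _ _
  | add f g hf hg =>
    simp only [map_add, add_smul, Finset.sum_add_distrib]
    exact hf.add hg
  | mul_X f i hf =>
    have hX : HasStrictFDerivAt (fun y : EuclideanSpace ℝ (Fin n) => y i)
      (EuclideanSpace.proj i : EuclideanSpace ℝ (Fin n) →L[ℝ] ℝ) x :=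
      (EuclideanSpace.proj i : EuclideanSpace ℝ (Fin n) →L[ℝ] ℝ).hasStrictFDerivAt
    have hd : (∑ l, aeval (fun l => x l) (pderiv l (f * X i)) •
        (EuclideanSpace.proj l : EuclideanSpace ℝ (Fin n) →L[ℝ] ℝ)) =
        aeval (fun l => x l) f • (EuclideanSpace.proj i : EuclideanSpace ℝ (Fin n) →L[ℝ] ℝ) +
          x i • ∑ l, aeval (fun l => x l) (pderiv l f) •
            (EuclideanSpace.proj l : EuclideanSpace ℝ (Fin n) →L[ℝ] ℝ) := by
      ext v
      simp [pderiv_X, Pi.single_apply, Finset.sum_add_distrib, Finset.mul_sum, add_mul, mul_assoc,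
        apply_ite, ite_mul]
    rw [hd]
    simp only [map_mul, aeval_X]
    exact hf.mul hX

variable {n p : ℕ} (F : Fin p → MvPolynomial (Fin n) ℚ)

/-- The real Jacobian matrix. -/
noncomputable def jacR (x : EuclideanSpace ℝ (Fin n)) : Matrix (Fin p) (Fin n) ℝ :=
  Matrix.of fun k l => aeval (fun l => x l) (pderiv l (F k))

variable {F}

theorem aeval_ofReal (x : EuclideanSpace ℝ (Fin n)) (f : MvPolynomial (Fin n) ℚ) :
    aeval (fun l => (x l : ℂ)) f = ((aeval (fun l => x l) f : ℝ) : ℂ) := by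
  have : (Complex.ofRealAm.restrictScalars ℚ).comp (aeval fun l => x l) =
      aeval (fun l => (x l : ℂ)) (R := ℚ) := by
    ext l
    simp
  rw [← this]
  rfl

theorem jacC_ofReal (x : EuclideanSpace ℝ (Fin n)) :
    jacC F (fun l => (x l : ℂ)) = (jacR F x).map Complex.ofReal := by
  ext k l
  simp [jacC, jacR, aeval_ofReal]

theorem mem_SR_iff {x : EuclideanSpace ℝ (Fin n)} :
    x ∈ SR F ↔ ∀ k, aeval (fun l => x l) (F k) = 0 := by
  simp [SR, zeroSetC, aeval_ofReal]

theorem mem_SregC_ofReal_iff {x : EuclideanSpace ℝ (Fin n)} :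
    (fun l => (x l : ℂ)) ∈ SregC F ↔
      x ∈ SR F ∧ ∃ e, ((jacR F x).submatrix id e).det ≠ 0 := by
  have hdet (e : Fin p → Fin n) : ((jacC F (fun l => (x l : ℂ))).submatrix id e).det =
      (((jacR F x).submatrix id e).det : ℂ) := by
    rw [jacC_ofReal, Matrix.submatrix_map]
    exact (Complex.ofRealHom.map_det _).symm
  refine and_congr Iff.rfl ⟨fun h => ?_, fun ⟨e, he⟩ => ?_⟩
  · obtain ⟨e, he⟩ := Matrix.exists_det_submatrix_ne_zero
      (Matrix.linearIndependent_row_iff_rank.mpr (h.trans (Fintype.card_fin p).symm))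
    refine ⟨e, ?_⟩
    rw [hdet] at he
    exact_mod_cast he
  · refine le_antisymm (by simpa using Matrix.rank_le_card_height (jacC F _)) ?_
    have hu : IsUnit ((jacC F (fun l => (x l : ℂ))).submatrix id e).det := by
      rw [hdet, isUnit_iff_ne_zero]
      exact_mod_cast he
    have h1 := Matrix.rank_of_isUnit _ ((Matrix.isUnit_iff_isUnit_det _).mpr hu)
    rw [Fintype.card_fin] at h1
    exact h1.symm.le.trans (Matrix.rank_submatrix_le _ _ _)

end RealPoints

section RealMinimizer

variable {n p : ℕ} {F : Fin p → MvPolynomial (Fin n) ℚ}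

theorem MvPolynomial.continuous_aeval_euclidean (f : MvPolynomial (Fin n) ℚ) :
    Continuous fun y : EuclideanSpace ℝ (Fin n) => aeval (fun l => y l) f :=
  continuous_iff_continuousAt.mpr fun x =>
    (MvPolynomial.hasStrictFDerivAt_aeval f x).hasFDerivAt.continuousAt

variable (F) in
theorem isClosed_SR : IsClosed (SR F) := by
  have : SR F = ⋂ k, {x | aeval (fun l => x l) (F k) = 0} := by
    ext x
    simp [mem_SR_iff]
  rw [this]
  exact isClosed_iInter fun k =>
    isClosed_eq (MvPolynomial.continuous_aeval_euclidean _) continuous_const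

theorem IsConnCompOf.isClosed {α : Type*} [TopologicalSpace α] {C T : Set α}
    (hC : IsConnCompOf C T) (hT : IsClosed T) : IsClosed C := by
  have h := hC.2.2.2 (closure C) subset_closure (closure_minimal hC.2.1 hT) hC.2.2.1.closure
  rw [← h]
  exact isClosed_closure

theorem jacR_submersion {x : EuclideanSpace ℝ (Fin n)} {e : Fin p → Fin n}
    (he : ((jacR F x).submatrix id e).det ≠ 0) :
    ((ContinuousLinearMap.pi fun k => ∑ l, jacR F x k l •
      (EuclideanSpace.proj l : EuclideanSpace ℝ (Fin n) →L[ℝ] ℝ) :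
        EuclideanSpace ℝ (Fin n) →L[ℝ] Fin p → ℝ) :
        EuclideanSpace ℝ (Fin n) →ₗ[ℝ] Fin p → ℝ).range = ⊤ := by
  rw [LinearMap.range_eq_top]
  intro y
  obtain ⟨v, hv⟩ := ((Matrix.mulVec_surjective_iff_isUnit).mpr
    ((Matrix.isUnit_iff_isUnit_det _).mpr (isUnit_iff_ne_zero.mpr he))) y
  refine ⟨∑ j, EuclideanSpace.single (e j) (v j), ?_⟩
  rw [← hv]
  ext k
  simp [Matrix.mulVec, dotProduct]

open Topology Filter in
theorem IsConnCompOf.eventually_mem {C : Set (EuclideanSpace ℝ (Fin n))}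
    (hC : IsConnCompOf C (SR F)) {x : EuclideanSpace ℝ (Fin n)} (hx : x ∈ C) {e : Fin p → Fin n}
    (he : ((jacR F x).submatrix id e).det ≠ 0) : ∀ᶠ y in 𝓝 x, y ∈ SR F → y ∈ C := by
  have hf : HasStrictFDerivAt
      (fun (y : EuclideanSpace ℝ (Fin n)) (k : Fin p) => aeval (fun l => y l) (F k))
      (ContinuousLinearMap.pi fun k => ∑ l, jacR F x k l •
        (EuclideanSpace.proj l : EuclideanSpace ℝ (Fin n) →L[ℝ] ℝ)) x :=
    hasStrictFDerivAt_pi.mpr fun k => MvPolynomial.hasStrictFDerivAt_aeval (F k) x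
  have hx0 : (fun k => aeval (fun l => x l) (F k)) = (0 : Fin p → ℝ) :=
    funext (mem_SR_iff.mp (hC.2.1 hx))
  obtain ⟨N, hN, hxN, hNc, hev⟩ := hf.exists_isPreconnected_fiber (jacR_submersion he)
  have hNS : N ⊆ SR F := fun y hy => mem_SR_iff.mpr fun k => congrFun ((hN hy).trans hx0) k
  have hCN : C ∪ N = C := hC.2.2.2 _ Set.subset_union_left (Set.union_subset hC.2.1 hNS)
    (hC.2.2.1.union x hx hxN hNc)
  filter_upwards [hev] with y hy hyS
  rw [← hCN]
  exact Or.inr (hy ((funext (mem_SR_iff.mp hyS)).trans hx0.symm))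

open Topology Filter in
/-- Points close to a regular point of `C` have a nearest point on `C` which is regular, and
the Lagrange multiplier rule holds there. -/
theorem IsConnCompOf.exists_multipliers {C : Set (EuclideanSpace ℝ (Fin n))}
    (hC : IsConnCompOf C (SR F)) {x₀ : EuclideanSpace ℝ (Fin n)} (hx₀ : x₀ ∈ C)
    (hreg : (fun l => (x₀ l : ℂ)) ∈ SregC F) :
    ∃ ε > 0, ∀ w ∈ Metric.ball x₀ ε, ∃ x ∈ C, (fun l => (x l : ℂ)) ∈ SregC F ∧
      ∃ (Λ : Fin p → ℝ) (Λ₀ : ℝ), (Λ, Λ₀) ≠ 0 ∧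
        ∀ l, ∑ k, Λ k * jacR F x k l + Λ₀ * (w l - x l) = 0 := by
  obtain ⟨e, he⟩ := (mem_SregC_ofReal_iff.mp hreg).2
  have hcont : Continuous fun x : EuclideanSpace ℝ (Fin n) =>
      ((jacR F x).submatrix id e).det := by
    refine Continuous.matrix_det (continuous_matrix fun k j => ?_)
    exact MvPolynomial.continuous_aeval_euclidean _
  obtain ⟨δ, hδ, hball⟩ := Metric.mem_nhds_iff.mp (hcont.continuousAt.eventually_ne he)
  refine ⟨δ / 2, half_pos hδ, fun w hw => ?_⟩
  obtain ⟨x, hxC, hx⟩ := (hC.isClosed (isClosed_SR F)).exists_infDist_eq_dist hC.1 w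
  have hmin (y) (hy : y ∈ C) : dist w x ≤ dist w y := hx ▸ Metric.infDist_le_dist_of_mem hy
  have hxdet : ((jacR F x).submatrix id e).det ≠ 0 := by
    apply hball
    have h1 := hmin x₀ hx₀
    rw [Metric.mem_ball] at hw ⊢
    linarith [dist_triangle_left x x₀ w]
  have hext : IsLocalExtrOn (fun y => ‖y - w‖ ^ 2)
      {y : EuclideanSpace ℝ (Fin n) |
        ∀ k, aeval (fun l => y l) (F k) = aeval (fun l => x l) (F k)} x := by
    refine Or.inl ?_
    filter_upwards [nhdsWithin_le_nhds (hC.eventually_mem hxC hxdet), self_mem_nhdsWithin]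
      with y hy hyS
    have hyC : y ∈ C := hy (mem_SR_iff.mpr fun k =>
      (hyS k).trans (mem_SR_iff.mp (hC.2.1 hxC) k))
    have := hmin y hyC
    rw [dist_comm w, dist_comm w, dist_eq_norm, dist_eq_norm] at this
    gcongr
  obtain ⟨Λ, Λ₀, hne, hsum⟩ := hext.exists_multipliers_of_hasStrictFDerivAt
    (fun k => MvPolynomial.hasStrictFDerivAt_aeval (F k) x)
    ((hasStrictFDerivAt_norm_sq (x - w)).comp x ((hasStrictFDerivAt_id x).sub_const w))
  refine ⟨x, hxC, mem_SregC_ofReal_iff.mpr ⟨hC.2.1 hxC, e, hxdet⟩, Λ, -2 * Λ₀, ?_, fun l => ?_⟩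
  · simpa [Prod.ext_iff] using hne
  · have h := congrArg (fun φ => φ (EuclideanSpace.single l 1)) hsum
    simp [EuclideanSpace.inner_single_right] at h
    simp only [jacR, Matrix.of_apply]
    linear_combination h

end RealMinimizer

section GenericMatrices

theorem MvPolynomial.exists_eval_ofReal_ne_zero {σ : Type*} [Fintype σ] {g : MvPolynomial σ ℂ}
    (hg : g ≠ 0) {U : Set (σ → ℝ)} (hU : IsOpen U) (hne : U.Nonempty) :
    ∃ x ∈ U, eval (fun q => (x q : ℂ)) g ≠ 0 := by
  obtain ⟨c, hc⟩ := hne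
  obtain ⟨ε, hε, hball⟩ := Metric.isOpen_iff.mp hU c hc
  by_contra! h
  refine hg (funext_set (fun q => Complex.ofReal '' Metric.ball (c q) ε) (fun q => ?_)
    fun y hy => ?_)
  · refine Set.Infinite.image Complex.ofReal_injective.injOn ?_
    rw [Real.ball_eq_Ioo]
    exact Set.Ioo_infinite (by linarith)
  · choose x hx hxy using fun q => hy q trivial
    obtain rfl : (fun q => (x q : ℂ)) = y := _root_.funext hxy
    rw [h x (hball ((ball_pi c hε).symm ▸ fun q _ => hx q)), map_zero]

variable {n p m : ℕ} {F : Fin p → MvPolynomial (Fin n) ℚ}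

/-- The minor of the generic matrix given by the first columns. -/
noncomputable def genericMinor (h : m ≤ n) : MvPolynomial (Fin m × Fin n) ℂ :=
  (Matrix.of fun k j => X (k, Fin.castLE h j) : Matrix (Fin m) (Fin m) _).det

theorem eval_genericMinor (h : m ≤ n) (a : Matrix (Fin m) (Fin n) ℂ) :
    eval (fun q => a q.1 q.2) (genericMinor h) = (a.submatrix id (Fin.castLE h)).det := by
  rw [genericMinor, RingHom.map_det]
  congr 1
  ext k j
  simp

theorem genericMinor_ne_zero (h : m ≤ n) : genericMinor h ≠ 0 := by
  intro h0
  have h1 := eval_genericMinor h (Matrix.of fun k l => if Fin.castLE h k = l then 1 else 0)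
  have h2 : (Matrix.of fun k l => if Fin.castLE h k = l then 1 else 0 :
      Matrix (Fin m) (Fin n) ℂ).submatrix id (Fin.castLE h) = 1 := by
    ext k j
    simp [Matrix.one_apply]
  rw [h0, h2, map_zero, Matrix.det_one] at h1
  exact zero_ne_one h1

theorem rank_eq_of_eval_genericMinor_ne_zero (h : m ≤ n) {a : Matrix (Fin m) (Fin n) ℝ}
    (ha : eval (fun q => (a q.1 q.2 : ℂ)) (genericMinor h) ≠ 0) : a.rank = m := by
  have h1 := eval_genericMinor h (a.map Complex.ofReal)
  have h2 : ((a.map Complex.ofReal).submatrix id (Fin.castLE h)).det =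
      ((a.submatrix id (Fin.castLE h)).det : ℂ) := by
    rw [Matrix.submatrix_map]
    exact (Complex.ofRealHom.map_det _).symm
  have h3 : (a.submatrix id (Fin.castLE h)).det ≠ 0 := by
    intro h0
    rw [h2, h0] at h1
    exact ha h1
  refine le_antisymm (by simpa using Matrix.rank_le_card_height a) ?_
  have h4 := Matrix.rank_of_isUnit _
    ((Matrix.isUnit_iff_isUnit_det _).mpr (isUnit_iff_ne_zero.mpr h3))
  rw [Fintype.card_fin] at h4
  exact h4.symm.le.trans (Matrix.rank_submatrix_le _ _ _)

theorem vanishingIdeal_zcl {σ : Type} (T : Set (σ → ℂ)) :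
    vanishingIdeal ℂ (zcl T) = vanishingIdeal ℂ T :=
  (zeroLocus_vanishingIdeal_galoisConnection (K := ℂ) (k := ℂ) (σ := σ)).u_l_u_eq_u T

theorem subset_zcl {σ : Type} (T : Set (σ → ℂ)) : T ⊆ zcl T := fun _ hx _ hf => hf _ hx

theorem jacobianAt_map (x : Fin n → ℂ) :
    jacobianAt (fun k => map (algebraMap ℚ ℂ) (F k)) x = jacC F x := by
  ext k l
  simp [jacobianAt, jacC, pderiv_map, aeval_map_algebraMap]

theorem zeroSetC_eq :
    zeroSetC F = {x | ∀ k, eval x (map (algebraMap ℚ ℂ) (F k)) = 0} := by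
  ext x
  simp [zeroSetC, eval_map, aeval_def]

theorem Wdual_eq_zcl_polarSet (a : Matrix (Fin (m + 1)) (Fin n) ℂ) :
    Wdual F a (p + m) = zcl (polarSet (fun k => map (algebraMap ℚ ℂ) (F k)) a) := by
  rw [Wdual]
  congr 1
  ext x
  have h : x ∈ zeroSetC F ↔ ∀ k, eval x (map (algebraMap ℚ ℂ) (F k)) = 0 := by
    rw [zeroSetC_eq]
    rfl
  change ((x ∈ zeroSetC F ∧ _) ∧ _) ↔ _ ∧ _ ∧ _
  rw [h, polarMatrix, jacobianAt_map, and_assoc, ← add_assoc, Nat.lt_succ_iff]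

theorem mem_Wdual_of_multipliers {x : EuclideanSpace ℝ (Fin n)} {Λ : Fin p → ℝ} {Λ₀ : ℝ}
    {a : Matrix (Fin (m + 1)) (Fin n) ℝ} (hx : (fun l => (x l : ℂ)) ∈ SregC F)
    (hne : (Λ, Λ₀) ≠ 0) (h : ∀ l, ∑ k, Λ k * jacR F x k l + Λ₀ * (a 0 l - x l) = 0) :
    (fun l => (x l : ℂ)) ∈ Wdual F (a.map fun t : ℝ => (t : ℂ)) (p + m) := by
  refine subset_zcl _ ⟨hx, ?_⟩
  rw [← Nat.lt_succ_iff]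
  let u : Fin p ⊕ Fin (m + 1) → ℂ := Sum.elim (fun k => Λ k) (Pi.single 0 (Λ₀ : ℂ))
  have hu : u ≠ 0 := by
    intro hu
    refine hne (Prod.ext (funext fun k => ?_) ?_)
    · simpa [u] using congrFun hu (Sum.inl k)
    · simpa [u] using congrFun hu (Sum.inr 0)
  refine (Matrix.rank_lt_of_vecMul_eq_zero hu ?_).trans_eq (by simp; rfl)
  ext l
  have hl : ((∑ k, Λ k * jacR F x k l + Λ₀ * (a 0 l - x l) : ℝ) : ℂ) = 0 := by
    rw [h l, Complex.ofReal_zero]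
  push_cast at hl
  simpa [u, Matrix.vecMul, dotProduct, jacC_ofReal, Pi.single_apply] using hl

end GenericMatrices

/-- Theorem 1 of the paper. Let `S` be as in the standing hypotheses,
`1 ≤ i ≤ n - p`, and let `C` be a connected component of `S_ℝ` containing a regular point
of `S`. Then there is a nonempty Euclidean-open set `O` of real
`(n-p-i+1) × n` matrices such that every `a ∈ O` has maximal rank `n-p-i+1`, the dual
polar variety `W_{K̄(ā)}(S)` is generic (empty or of pure codimension `i` in `S`, i.e. of
pure dimension `n-p-i`), and the real dual polar variety `W_{K̄(ā)}(S_ℝ)` contains a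
regular point of `C`. -/
theorem statement1 {n p i : ℕ} (hp1 : 1 ≤ p) (hpn : p ≤ n)
    (hi1 : 1 ≤ i) (hi2 : i ≤ n - p)
    (F : Fin p → MvPolynomial (Fin n) ℚ)
    (hreg : IsRegSeq (List.ofFn F))
    (hrad : idealOfDef F)
    (hSne : (zeroSetC F).Nonempty)
    (hSdim : IsPureDim (zeroSetC F) (n - p))
    (C : Set (EuclideanSpace ℝ (Fin n)))
    (hC : IsConnCompOf C (SR F))
    (hCreg : ∃ x ∈ C, (fun j => (x j : ℂ)) ∈ SregC F) :
    ∃ O : Set (Matrix (Fin (n - p - i + 1)) (Fin n) ℝ),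
      O.Nonempty ∧ IsOpen O ∧
      ∀ a ∈ O,
        a.rank = n - p - i + 1 ∧
        (Wdual F (a.map (fun t : ℝ => (t : ℂ))) (n - i) = ∅ ∨
          IsPureDim (Wdual F (a.map (fun t : ℝ => (t : ℂ))) (n - i)) (n - p - i)) ∧
        ∃ x : EuclideanSpace ℝ (Fin n),
          x ∈ C ∧ (fun j => (x j : ℂ)) ∈ SregC F ∧
          (fun j => (x j : ℂ)) ∈ Wdual F (a.map (fun t : ℝ => (t : ℂ))) (n - i) := by
  obtain ⟨x₀, hx₀C, hx₀⟩ := hCreg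
  obtain ⟨m, hm⟩ : ∃ m, m = n - p - i := ⟨_, rfl⟩
  obtain hr : n - i = p + m := by omega
  have hmn : m + 1 ≤ n := by omega
  rw [← hm, hr]
  rw [zeroSetC_eq] at hSdim
  obtain ⟨g, hg, hdim⟩ := exists_forall_ringKrullDim_polarSet_eq (m := m) (d := n - p)
    (Nat.sub_add_cancel hpn) (by omega) hSdim
  obtain ⟨ε, hε, hball⟩ := hC.exists_multipliers hx₀C hx₀
  have hg' : g * genericMinor hmn ≠ 0 := mul_ne_zero hg (genericMinor_ne_zero hmn)
  have hcont : Continuous fun a : Matrix (Fin (m + 1)) (Fin n) ℝ => WithLp.toLp 2 (a 0) :=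
    (PiLp.continuous_toLp 2 _).comp (continuous_apply (0 : Fin (m + 1)))
  have hopen := (Metric.isOpen_ball (x := x₀) (ε := ε)).preimage hcont
  have hcont' : Continuous fun a : Matrix (Fin (m + 1)) (Fin n) ℝ =>
      eval (fun q => (a q.1 q.2 : ℂ)) (g * genericMinor hmn) :=
    (MvPolynomial.continuous_eval _).comp (continuous_pi fun q =>
      Complex.continuous_ofReal.comp (continuous_apply_apply q.1 q.2))
  refine ⟨{a | WithLp.toLp 2 (a 0) ∈ Metric.ball x₀ ε} ∩
    {a | eval (fun q => (a q.1 q.2 : ℂ)) (g * genericMinor hmn) ≠ 0}, ?_,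
    hopen.inter (isOpen_compl_singleton.preimage hcont'), fun a ⟨ha₀, ha⟩ => ?_⟩
  · have hcurry : Continuous fun (b : Fin (m + 1) × Fin n → ℝ) =>
        (Matrix.of fun k l => b (k, l) : Matrix (Fin (m + 1)) (Fin n) ℝ) :=
      continuous_matrix fun k l => continuous_apply (k, l)
    obtain ⟨b, hb, hbg⟩ := MvPolynomial.exists_eval_ofReal_ne_zero hg' (hopen.preimage hcurry)
      ⟨fun q => x₀ q.2, Metric.mem_ball_self hε⟩
    exact ⟨Matrix.of fun k l => b (k, l), hb, hbg⟩
  · have ha' : eval (fun q => (a q.1 q.2 : ℂ)) g *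
        eval (fun q => (a q.1 q.2 : ℂ)) (genericMinor hmn) ≠ 0 := by
      rw [← map_mul]
      exact ha
    refine ⟨rank_eq_of_eval_genericMinor_ne_zero hmn (right_ne_zero_of_mul ha'), Or.inr ?_, ?_⟩
    · rw [Wdual_eq_zcl_polarSet, IsPureDim, vanishingIdeal_zcl]
      exact hdim _ (left_ne_zero_of_mul ha')
    · obtain ⟨x, hxC, hx, Λ, Λ₀, hne, hΛ⟩ := hball _ ha₀
      exact ⟨x, hxC, hx, mem_Wdual_of_multipliers hx hne hΛ⟩
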